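/- arXiv:2509.09410 — 2 statements merged into one kernel-verified Lean document; each statement's English description precedes it below -/
import Mathlib

section
/- Uniform estimate for the flux-corrector equation under weak scale separation (Theorem 4.4): For all integers d ≥ 1 and n ≥ 2 there exist constants C ≥ 1, C̃ ≥ 1 and Cₙ ≥ 1, depending only on d and n, such that the following holds for any Λ₁ ≥ 1, q ∈ ℕ and τ ∈ (0,1]. Let G : (ℝ^d)^n → ℝ be smooth and multiperiodic with ⟨G⟩ = 0 and ‖|D^ℓ G|‖_{L²} ≤ Λ₁^ℓ·(ℓ+q)! for all ℓ ∈ ℕ. If ℓ ∈ ℕ is such that for every 2 ≤ j ≤ n there exists an integer kⱼ ≥ 2 with (δⱼ/δⱼ₋₁)·C·Λ₁·(ℓ + kⱼ + q) ≤ e⁻¹ and τ² ≥ C̃·e^{−kⱼ}, then the equation −Δ̂U + τ²·U = G has exactly one smooth multiperiodic solution U : (ℝ^d)^n → ℝ, and it satisfies ‖|D^ℓ U|‖_{L²} ≤ Cₙ·Λ₁^ℓ·(ℓ+q)!. -/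
open MeasureTheory Real

noncomputable section

namespace MS

/-- Points of `(ℝ^d)^n`. -/
abbrev Dom (d n : ℕ) := Fin n → Fin d → ℝ

/-- Partial derivative of `u` in the coordinate direction `y_i^k`. -/
def pd {d n : ℕ} (i : Fin n) (k : Fin d) (u : Dom d n → ℝ) (y : Dom d n) : ℝ :=
  fderiv ℝ u y (Pi.single i (Pi.single k 1))

/-- Multiperiodicity: invariance under integer translations in each argument. -/
def MPeriodic {d n : ℕ} (u : Dom d n → ℝ) : Prop :=
  ∀ (y : Dom d n) (z : Fin n → Fin d → ℤ), u (fun i k => y i k + (z i k : ℝ)) = u y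

/-- The unit periodicity cell `[0,1]^{d × n}`. -/
def cell (d n : ℕ) : Set (Dom d n) := Set.Icc 0 1

/-- Pointwise `|D^ℓ u|`: the sum, over all ℓ-tuples of coordinate directions, of the
absolute values of the corresponding ℓ-th order partial derivatives of the scalar `u`. -/
def DAbs {d n : ℕ} (ℓ : ℕ) (u : Dom d n → ℝ) (y : Dom d n) : ℝ :=
  ∑ idx : Fin ℓ → Fin n × Fin d,
    |iteratedFDeriv ℝ ℓ u y fun m => Pi.single (idx m).1 (Pi.single (idx m).2 1)|

/-- L² norm over the unit cell. -/
def L2 {d n : ℕ} (F : Dom d n → ℝ) : ℝ :=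
  Real.sqrt (∫ y in cell d n, (F y) ^ 2)

/-- k-th component of the truncated directional gradient `Σ_{i<m} δ_i⁻¹ ∂/∂y_i^k`;
with `m = n` this is the k-th component of `∇̂`. -/
def gradHatC {d n : ℕ} (δ : Fin n → ℝ) (m : ℕ) (k : Fin d) (u : Dom d n → ℝ) (y : Dom d n) : ℝ :=
  ∑ i : Fin n, if (i : ℕ) < m then (δ i)⁻¹ * pd i k u y else 0

/-- λ-ellipticity of a matrix-valued map: `ξ·Aξ ≥ λ|ξ|²` and `|Aξ| ≤ λ⁻¹|ξ|`. -/
def Elliptic {d n : ℕ} (lam : ℝ) (A : Dom d n → Fin d → Fin d → ℝ) : Prop :=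
  ∀ (y : Dom d n) (ξ : Fin d → ℝ),
    (lam * ∑ k, ξ k ^ 2 ≤ ∑ k, ξ k * ∑ l, A y k l * ξ l) ∧
    Real.sqrt (∑ k, (∑ l, A y k l * ξ l) ^ 2) ≤ lam⁻¹ * Real.sqrt (∑ k, ξ k ^ 2)

section Torus

variable {d n : ℕ}

/-- Haar probability measure on `ℝ / ℤ`, the normalisation used for Fourier series. -/
local instance : MeasureSpace UnitAddCircle := ⟨AddCircle.haarAddCircle⟩

local instance : Measure.IsAddHaarMeasure (volume : Measure UnitAddCircle) :=
  inferInstanceAs (Measure.IsAddHaarMeasure AddCircle.haarAddCircle)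

local instance : IsProbabilityMeasure (volume : Measure UnitAddCircle) :=
  inferInstanceAs (IsProbabilityMeasure AddCircle.haarAddCircle)

/-- Projection of `(ℝ^d)^n` onto the torus. -/
def toTorus (y : Dom d n) : UnitAddTorus (Fin n × Fin d) := fun p => (y p.1 p.2 : UnitAddCircle)

/-- Multiperiodicity for functions with values in an arbitrary type. -/
def Periodic {E : Type*} (f : Dom d n → E) : Prop :=
  ∀ (y : Dom d n) (z : Fin n → Fin d → ℤ), f (fun i k => y i k + (z i k : ℝ)) = f y

lemma toTorus_add (x y : Dom d n) : toTorus (x + y) = toTorus x + toTorus y := by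
  ext p; simp [toTorus]

lemma isOpenQuotientMap_toTorus : IsOpenQuotientMap (toTorus (d := d) (n := n)) := by
  have h1 : IsOpenQuotientMap (fun (x : Fin n × Fin d → ℝ) p => (x p : UnitAddCircle)) :=
    IsOpenQuotientMap.piMap fun _ => QuotientAddGroup.isOpenQuotientMap_mk
  have h2 : IsOpenQuotientMap (fun (y : Dom d n) (p : Fin n × Fin d) => y p.1 p.2) := by
    refine Homeomorph.isOpenQuotientMap
      ⟨⟨_, fun x i k => x (i, k), fun _ => rfl, fun _ => rfl⟩, ?_, ?_⟩
    · simp only; fun_prop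
    · simp only; fun_prop
  exact h1.comp h2

lemma volume_restrict_cell : (volume : Measure (Dom d n)).restrict (cell d n) =
    Measure.pi fun _ => Measure.pi fun _ => (volume : Measure ℝ).restrict (Set.Ioc 0 (0 + 1)) := by
  have h : (volume : Measure ℝ).restrict (Set.Ioc 0 (0 + 1)) =
      (volume : Measure ℝ).restrict (Set.Icc 0 1) := by
    rw [zero_add]; exact Measure.restrict_congr_set Ioc_ae_eq_Icc
  have hc : cell d n = Set.univ.pi fun _ => Set.univ.pi fun _ => Set.Icc (0 : ℝ) 1 := by
    ext y; simp [cell, Pi.le_def]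
  rw [h, hc, volume_pi, Measure.restrict_pi_pi]
  simp_rw [volume_pi, Measure.restrict_pi_pi]

lemma measurePreserving_toTorus : MeasurePreserving (toTorus (d := d) (n := n))
    (volume.restrict (cell d n)) volume := by
  have h1 : MeasurePreserving (fun (x : Fin n × Fin d → ℝ) p => (x p : UnitAddCircle))
      (Measure.pi fun _ => (volume : Measure ℝ).restrict (Set.Ioc 0 (0 + 1))) volume := by
    refine measurePreserving_pi _ _ fun _ => ?_
    have := AddCircle.measurePreserving_mk 1 0
    rw [AddCircle.volume_eq_smul_haarAddCircle] at this
    simp only [ENNReal.ofReal_one, one_smul] at this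
    exact this
  refine h1.comp (g := fun (x : Fin n × Fin d → ℝ) p => (x p : UnitAddCircle))
    (f := fun (y : Dom d n) (p : Fin n × Fin d) => y p.1 p.2) ⟨by fun_prop, ?_⟩
  rw [volume_restrict_cell]
  refine (Measure.pi_eq fun s hs => ?_).symm
  rw [Measure.map_apply (by fun_prop) (MeasurableSet.univ_pi hs)]
  have : (fun (y : Dom d n) (p : Fin n × Fin d) => y p.1 p.2) ⁻¹' Set.univ.pi s =
      Set.univ.pi fun i => Set.univ.pi fun k => s (i, k) := by
    ext y; simp
  rw [this, Measure.pi_pi]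
  simp_rw [Measure.pi_pi]
  rw [Fintype.prod_prod_type]

lemma exists_lift {E : Type*} [TopologicalSpace E] {f : Dom d n → E} (hf : Continuous f)
    (hp : Periodic f) : ∃ F : UnitAddTorus (Fin n × Fin d) → E, Continuous F ∧
      ∀ y, F (toTorus y) = f y := by
  have key : Function.FactorsThrough f (toTorus (d := d) (n := n)) := by
    intro x y hxy
    have : ∀ i k, ∃ m : ℤ, x i k + (m : ℝ) = y i k := by
      intro i k
      have := congrFun hxy (i, k)
      simp only [toTorus] at this
      rw [QuotientAddGroup.eq, AddSubgroup.mem_zmultiples_iff] at this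
      obtain ⟨m, hm⟩ := this
      refine ⟨m, ?_⟩
      simp only [zsmul_eq_mul, mul_one] at hm
      rw [hm]; ring
    choose z hz using this
    rw [← hp x z]
    simp_rw [hz]
  refine ⟨Function.extend toTorus f fun _ => f 0, ?_, fun y => key.extend_apply _ y⟩
  rw [isOpenQuotientMap_toTorus.isQuotientMap.continuous_iff]
  convert hf using 1
  ext y
  exact key.extend_apply _ y

lemma integral_cell_lift {E : Type*} [NormedAddCommGroup E] [NormedSpace ℝ E]
    {F : UnitAddTorus (Fin n × Fin d) → E} (hF : Continuous F) :
    ∫ y in cell d n, F (toTorus y) = ∫ t, F t := by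
  rw [← measurePreserving_toTorus.map_eq, integral_map]
  · exact measurePreserving_toTorus.measurable.aemeasurable
  · exact hF.aestronglyMeasurable

lemma integral_cell_add {E : Type*} [NormedAddCommGroup E] [NormedSpace ℝ E] {f : Dom d n → E}
    (hf : Continuous f) (hp : Periodic f) (a : Dom d n) :
    ∫ y in cell d n, f (y + a) = ∫ y in cell d n, f y := by
  obtain ⟨F, hF, h⟩ := exists_lift hf hp
  simp_rw [← h, toTorus_add]
  rw [integral_cell_lift hF, integral_cell_lift (F := fun t => F (t + toTorus a)) (by fun_prop),
    integral_add_right_eq_self]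

/-- The Fourier mode with frequency `ν`, as a function on `(ℝ^d)^n`. -/
def mode (ν : Fin n × Fin d → ℤ) (y : Dom d n) : ℂ :=
  Complex.exp (2 * π * Complex.I * (∑ p, (ν p : ℝ) * y p.1 p.2 : ℝ))

/-- Fourier coefficients of a function on `(ℝ^d)^n`. -/
def coeff (f : Dom d n → ℝ) (ν : Fin n × Fin d → ℤ) : ℂ :=
  ∫ y in cell d n, mode (-ν) y * f y

lemma mode_eq (ν : Fin n × Fin d → ℤ) (y : Dom d n) :
    mode ν y = UnitAddTorus.mFourier ν (toTorus y) := by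
  simp only [mode, UnitAddTorus.mFourier, toTorus, ContinuousMap.coe_mk, fourier_coe_apply,
    ← Complex.exp_sum]
  push_cast
  rw [Finset.mul_sum]
  congr 1
  refine Finset.sum_congr rfl fun p _ => ?_
  simp; ring

lemma hasSum_coeff_sq {f : Dom d n → ℝ} (hf : Continuous f) (hp : Periodic f) :
    HasSum (fun ν => ‖coeff f ν‖ ^ 2) (∫ y in cell d n, f y ^ 2) := by
  obtain ⟨F, hF, h⟩ := exists_lift hf hp
  let g : C(UnitAddTorus (Fin n × Fin d), ℂ) := ⟨fun t => (F t : ℂ), by fun_prop⟩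
  have := UnitAddTorus.hasSum_sq_mFourierCoeff (ContinuousMap.toLp 2 volume ℂ g)
  have e1 : ∫ t, ‖(ContinuousMap.toLp 2 volume ℂ g) t‖ ^ 2 = ∫ y in cell d n, f y ^ 2 := by
    simp_rw [← h]
    rw [integral_cell_lift (F := fun t => F t ^ 2) (by fun_prop)]
    refine integral_congr_ae ?_
    filter_upwards [ContinuousMap.coeFn_toLp (p := 2) (𝕜 := ℂ) volume g] with t ht
    rw [ht]
    simp [g]
  rw [e1] at this
  convert this using 3 with ν
  rw [UnitAddTorus.mFourierCoeff_toLp, coeff, UnitAddTorus.mFourierCoeff]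
  simp_rw [mode_eq, ← h]
  rw [integral_cell_lift (F := fun t => UnitAddTorus.mFourier (-ν) t * (F t : ℂ)) (by fun_prop)]
  rfl

lemma eq_zero_of_integral_sq_eq_zero {f : Dom d n → ℝ} (hf : Continuous f) (hp : Periodic f)
    (h0 : ∫ y in cell d n, f y ^ 2 = 0) (y : Dom d n) : f y = 0 := by
  obtain ⟨F, hF, h⟩ := exists_lift hf hp
  simp_rw [← h] at h0 ⊢
  rw [integral_cell_lift (F := fun t => F t ^ 2) (by fun_prop),
    integral_eq_zero_iff_of_nonneg (fun t => sq_nonneg _)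
      ((hF.pow 2).integrable_of_hasCompactSupport (HasCompactSupport.of_compactSpace _))] at h0
  have := (Continuous.ae_eq_iff_eq volume (hF.pow 2) continuous_const).1 h0
  exact (pow_eq_zero_iff two_ne_zero).1 (congrFun this (toTorus y))

end Torus

section Calculus

variable {d n : ℕ}

lemma Periodic.exists_bound {E : Type*} [NormedAddCommGroup E] {f : Dom d n → E}
    (hf : Continuous f) (hp : Periodic f) : ∃ C, ∀ y, ‖f y‖ ≤ C := by
  obtain ⟨F, hF, h⟩ := exists_lift hf hp
  obtain ⟨C, hC⟩ := isCompact_univ.exists_bound_of_continuousOn hF.continuousOn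
  exact ⟨C, fun y => h y ▸ hC _ (Set.mem_univ _)⟩

lemma Periodic.fderiv {E : Type*} [NormedAddCommGroup E] [NormedSpace ℝ E] {f : Dom d n → E}
    (hp : Periodic f) : Periodic (fderiv ℝ f) := by
  intro y z
  have h : (fun x : Dom d n => f (x + fun i k => (z i k : ℝ))) = f := funext fun x => hp x z
  conv_rhs => rw [← h]
  rw [fderiv_comp_add_right]
  rfl

/-- Smooth multiperiodic scalar functions. -/
structure SmoothPeriodic (f : Dom d n → ℝ) : Prop where
  smooth : ContDiff ℝ (⊤ : ℕ∞) f
  periodic : Periodic f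

/-- The unit vector of `(ℝ^d)^n` in the coordinate direction `p`. -/
def unit (p : Fin n × Fin d) : Dom d n := Pi.single p.1 (Pi.single p.2 1)

/-- Iterated partial derivatives along a list of coordinate directions. -/
def pds (l : List (Fin n × Fin d)) (f : Dom d n → ℝ) : Dom d n → ℝ :=
  l.foldr (fun p g => pd p.1 p.2 g) f

lemma SmoothPeriodic.pd {f : Dom d n → ℝ} (hf : SmoothPeriodic f) (i : Fin n) (k : Fin d) :
    SmoothPeriodic (pd i k f) where
  smooth := by
    have : ContDiff ℝ (⊤ : ℕ∞) (_root_.fderiv ℝ f) := hf.smooth.fderiv_right (by simp)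
    exact this.clm_apply contDiff_const
  periodic y z := by
    unfold MS.pd
    rw [hf.periodic.fderiv y z]

lemma SmoothPeriodic.pds {f : Dom d n → ℝ} (hf : SmoothPeriodic f) (l : List (Fin n × Fin d)) :
    SmoothPeriodic (pds l f) := by
  induction l with
  | nil => exact hf
  | cons p l ih => exact ih.pd p.1 p.2

lemma SmoothPeriodic.continuous {f : Dom d n → ℝ} (hf : SmoothPeriodic f) : Continuous f :=
  hf.smooth.continuous

lemma SmoothPeriodic.add {f g : Dom d n → ℝ} (hf : SmoothPeriodic f) (hg : SmoothPeriodic g) :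
    SmoothPeriodic (fun y => f y + g y) :=
  ⟨hf.smooth.add hg.smooth, fun y z => by simp only [hf.periodic y z, hg.periodic y z]⟩

lemma SmoothPeriodic.const_mul {f : Dom d n → ℝ} (hf : SmoothPeriodic f) (c : ℝ) :
    SmoothPeriodic (fun y => c * f y) :=
  ⟨contDiff_const.mul hf.smooth, fun y z => by simp only [hf.periodic y z]⟩

lemma SmoothPeriodic.sum {ι : Type*} {f : ι → Dom d n → ℝ} (s : Finset ι)
    (hf : ∀ i ∈ s, SmoothPeriodic (f i)) : SmoothPeriodic (fun y => ∑ i ∈ s, f i y) :=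
  ⟨ContDiff.sum fun i hi => (hf i hi).smooth,
    fun y z => Finset.sum_congr rfl fun i hi => (hf i hi).periodic y z⟩

lemma iteratedFDeriv_unit {f : Dom d n → ℝ} (hf : SmoothPeriodic f) {ℓ : ℕ}
    (idx : Fin ℓ → Fin n × Fin d) (y : Dom d n) :
    iteratedFDeriv ℝ ℓ f y (fun m => unit (idx m)) = pds (List.ofFn idx) f y := by
  induction ℓ generalizing y with
  | zero => simp [pds]
  | succ ℓ ih =>
    rw [iteratedFDeriv_succ_apply_left, List.ofFn_succ]
    have hd : DifferentiableAt ℝ (iteratedFDeriv ℝ ℓ f) y :=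
      hf.smooth.differentiable_iteratedFDeriv (by exact_mod_cast ENat.natCast_lt_top ℓ) y
    have h2 := funext fun y => ih (fun m => idx m.succ) y
    change _ = fderiv ℝ (pds (List.ofFn fun m => idx m.succ) f) y (unit (idx 0))
    rw [← h2, fderiv_continuousMultilinear_apply_const_apply hd]
    rfl

lemma DAbs_eq {f : Dom d n → ℝ} (hf : SmoothPeriodic f) (ℓ : ℕ) (y : Dom d n) :
    DAbs ℓ f y = ∑ idx : Fin ℓ → Fin n × Fin d, |pds (List.ofFn idx) f y| := by
  unfold DAbs
  exact Finset.sum_congr rfl fun idx _ => congrArg _ (iteratedFDeriv_unit hf idx y)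

lemma pds_add {f g : Dom d n → ℝ} (hf : SmoothPeriodic f) (hg : SmoothPeriodic g)
    (l : List (Fin n × Fin d)) :
    pds l (fun y => f y + g y) = fun y => pds l f y + pds l g y := by
  induction l with
  | nil => rfl
  | cons p l ih =>
    change pd p.1 p.2 (pds l _) = _
    rw [ih]
    ext y
    simp only [pd]
    rw [fderiv_fun_add ((hf.pds l).smooth.differentiable (by simp) y)
      ((hg.pds l).smooth.differentiable (by simp) y)]
    rfl

lemma pds_const_mul {f : Dom d n → ℝ} (hf : SmoothPeriodic f) (c : ℝ)
    (l : List (Fin n × Fin d)) : pds l (fun y => c * f y) = fun y => c * pds l f y := by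
  induction l with
  | nil => rfl
  | cons p l ih =>
    change pd p.1 p.2 (pds l _) = _
    rw [ih]
    ext y
    simp only [pd]
    rw [fderiv_const_mul ((hf.pds l).smooth.differentiable (by simp) y)]
    rfl

lemma mode_add (ν : Fin n × Fin d → ℤ) (x y : Dom d n) :
    mode ν (x + y) = mode ν x * mode ν y := by
  simp only [mode, ← Complex.exp_add, Pi.add_apply, mul_add, Finset.sum_add_distrib]
  push_cast
  ring_nf

lemma mode_neg_neg (ν : Fin n × Fin d → ℤ) (y : Dom d n) : mode (-ν) (-y) = mode ν y := by
  simp [mode]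

lemma norm_mode (ν : Fin n × Fin d → ℤ) (y : Dom d n) : ‖mode ν y‖ = 1 := by
  rw [mode, mul_right_comm, ← Complex.norm_exp_ofReal_mul_I (2 * π * ∑ p, (ν p : ℝ) * y p.1 p.2)]
  push_cast; rfl

@[fun_prop]
lemma continuous_mode (ν : Fin n × Fin d → ℤ) : Continuous (mode (d := d) ν) := by
  unfold mode; fun_prop

lemma periodic_mode (ν : Fin n × Fin d → ℤ) : Periodic (mode (d := d) ν) := by
  intro y z
  change mode ν (y + fun i k => (z i k : ℝ)) = _
  rw [mode_eq, mode_eq, toTorus_add]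
  congr 1
  rw [add_eq_left]
  ext p
  simp only [toTorus, Pi.zero_apply]
  exact (AddCircle.coe_eq_zero_iff 1).2 ⟨z p.1 p.2, by simp⟩

lemma coeff_translate {f : Dom d n → ℝ} (hf : Continuous f) (hp : Periodic f)
    (ν : Fin n × Fin d → ℤ) (a : Dom d n) :
    coeff (fun y => f (y + a)) ν = mode ν a * coeff f ν := by
  have h := integral_cell_add (f := fun y => mode (-ν) (y - a) * (f y : ℂ)) (by fun_prop)
    (fun y z => by
      have h1 := periodic_mode (-ν) (y - a) z
      have h2 : (fun i k => (y - a) i k + (z i k : ℝ)) = (fun i k => y i k + (z i k : ℝ)) - a := by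
        ext i k; simp only [Pi.sub_apply]; ring
      rw [h2] at h1
      simp only [h1, hp y z]) a
  simp only [add_sub_cancel_right] at h
  rw [coeff, h, coeff, ← integral_const_mul]
  congr 1
  ext y
  rw [sub_eq_add_neg, mode_add, mode_neg_neg]
  ring

lemma hasDerivAt_mode (ν : Fin n × Fin d → ℤ) (p : Fin n × Fin d) :
    HasDerivAt (fun t : ℝ => mode ν (t • unit p)) (2 * π * Complex.I * ν p) 0 := by
  have h : (fun t : ℝ => mode ν (t • unit p)) =
      fun t : ℝ => Complex.exp (2 * π * Complex.I * ν p * (t : ℂ)) := by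
    ext t
    have : ∑ q : Fin n × Fin d, (ν q : ℝ) * (t • unit p) q.1 q.2 = ν p * t := by
      rw [Finset.sum_eq_single p]
      · simp [unit]
      · intro q _ hq
        simp only [unit, Pi.smul_apply, smul_eq_mul, mul_eq_zero]
        right; right
        by_cases h1 : q.1 = p.1
        · have h2 : q.2 ≠ p.2 := fun h2 => hq (Prod.ext h1 h2)
          rw [h1, Pi.single_eq_same, Pi.single_eq_of_ne h2]
        · rw [Pi.single_eq_of_ne h1]; rfl
      · simp
    rw [mode, this]
    push_cast; ring_nf
  rw [h]
  have h1 : HasDerivAt (fun t : ℝ => 2 * π * Complex.I * ν p * (t : ℂ))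
      (2 * π * Complex.I * ν p * 1) 0 := (Complex.ofRealCLM.hasDerivAt).const_mul _
  simpa using h1.cexp

lemma isFiniteMeasure_cell : IsFiniteMeasure ((volume : Measure (Dom d n)).restrict (cell d n)) :=
  ⟨by rw [Measure.restrict_apply_univ]; exact isCompact_Icc.measure_lt_top⟩

lemma coeff_pd {f : Dom d n → ℝ} (hf : SmoothPeriodic f) (p : Fin n × Fin d)
    (ν : Fin n × Fin d → ℤ) :
    coeff (pd p.1 p.2 f) ν = 2 * π * Complex.I * ν p * coeff f ν := by
  have := isFiniteMeasure_cell (d := d) (n := n)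
  obtain ⟨C, hC⟩ := (hf.pd p.1 p.2).periodic.exists_bound (hf.pd p.1 p.2).continuous
  have hfc := hf.continuous
  have hpc := (hf.pd p.1 p.2).continuous
  have h1 := hasDerivAt_integral_of_dominated_loc_of_deriv_le
    (μ := (volume : Measure (Dom d n)).restrict (cell d n))
    (F := fun (t : ℝ) y => mode (-ν) y * (f (y + t • unit p) : ℂ))
    (F' := fun (t : ℝ) y => mode (-ν) y * (pd p.1 p.2 f (y + t • unit p) : ℂ))
    (x₀ := 0) (s := Set.univ) (bound := fun _ => C) Filter.univ_mem
    (Filter.Eventually.of_forall fun t => by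
      refine Continuous.aestronglyMeasurable ?_; fun_prop)
    (by
      refine (Continuous.integrableOn_Icc ?_)
      fun_prop)
    (by refine Continuous.aestronglyMeasurable ?_; fun_prop)
    (Filter.Eventually.of_forall fun y t _ => by
      rw [norm_mul, norm_mode, one_mul, Complex.norm_real]
      exact hC _)
    (integrable_const C)
    (Filter.Eventually.of_forall fun y t _ => by
      refine HasDerivAt.const_mul _ (HasDerivAt.ofReal_comp ?_)
      have h2 : HasDerivAt (fun t : ℝ => y + t • unit p) (unit p) t := by
        simpa using ((hasDerivAt_id t).smul_const (unit p)).const_add y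
      exact (hf.smooth.differentiable (by simp) _).hasFDerivAt.comp_hasDerivAt t h2)
  have h3 := h1.2
  simp only [zero_smul, add_zero] at h3
  have h4 : (fun t : ℝ => ∫ y in cell d n, mode (-ν) y * (f (y + t • unit p) : ℂ)) =
      fun t : ℝ => mode ν (t • unit p) * coeff f ν :=
    funext fun t => coeff_translate hfc hf.periodic ν _
  rw [h4] at h3
  exact h3.unique ((hasDerivAt_mode ν p).mul_const _)

lemma coeff_pds {f : Dom d n → ℝ} (hf : SmoothPeriodic f) (l : List (Fin n × Fin d))
    (ν : Fin n × Fin d → ℤ) :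
    coeff (pds l f) ν = (l.map fun p => 2 * π * Complex.I * (ν p : ℂ)).prod * coeff f ν := by
  induction l with
  | nil => simp [pds]
  | cons p l ih =>
    change coeff (pd p.1 p.2 (pds l f)) ν = _
    rw [coeff_pd (hf.pds l), ih, List.map_cons, List.prod_cons]
    ring

lemma integrable_mode_mul {f : Dom d n → ℝ} (hf : Continuous f) (ν : Fin n × Fin d → ℤ) :
    IntegrableOn (fun y => mode (-ν) y * (f y : ℂ)) (cell d n) :=
  Continuous.integrableOn_Icc (by fun_prop)

lemma coeff_add {f g : Dom d n → ℝ} (hf : Continuous f) (hg : Continuous g)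
    (ν : Fin n × Fin d → ℤ) : coeff (fun y => f y + g y) ν = coeff f ν + coeff g ν := by
  unfold coeff
  rw [← integral_add (integrable_mode_mul hf ν) (integrable_mode_mul hg ν)]
  push_cast
  simp_rw [mul_add]

lemma coeff_const_mul (f : Dom d n → ℝ) (c : ℝ) (ν : Fin n × Fin d → ℤ) :
    coeff (fun y => c * f y) ν = c * coeff f ν := by
  unfold coeff
  rw [← integral_const_mul]
  push_cast
  simp_rw [mul_left_comm]

lemma coeff_sum {ι : Type*} (s : Finset ι) {f : ι → Dom d n → ℝ}
    (hf : ∀ i ∈ s, Continuous (f i)) (ν : Fin n × Fin d → ℤ) :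
    coeff (fun y => ∑ i ∈ s, f i y) ν = ∑ i ∈ s, coeff (f i) ν := by
  unfold coeff
  rw [← integral_finsetSum s fun i hi => integrable_mode_mul (hf i hi) ν]
  push_cast
  simp_rw [Finset.mul_sum]

lemma eq_of_coeff_eq {f g : Dom d n → ℝ} (hf : SmoothPeriodic f) (hg : SmoothPeriodic g)
    (h : ∀ ν, coeff f ν = coeff g ν) : f = g := by
  have hfg := hf.add (hg.const_mul (-1))
  have hc : ∀ ν, coeff (fun y => f y + -1 * g y) ν = 0 := fun ν => by
    rw [coeff_add hf.continuous (hg.const_mul _).continuous, coeff_const_mul, h]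
    push_cast; ring
  have hs := hasSum_coeff_sq hfg.continuous hfg.periodic
  simp only [hc, norm_zero, ne_eq, OfNat.ofNat_ne_zero, not_false_eq_true, zero_pow] at hs
  have h0 := hs.unique hasSum_zero
  ext y
  linarith [eq_zero_of_integral_sq_eq_zero hfg.continuous hfg.periodic h0 y]

end Calculus

section Averaging

variable {d n : ℕ} {Ω : Type*} [MeasurableSpace Ω]

/-- Weighted average of the translates `f (· - X ω)`. -/
def avg {E : Type*} [NormedAddCommGroup E] [NormedSpace ℝ E] (μ : Measure Ω) (w : Ω → ℝ)
    (X : Ω → Dom d n) (f : Dom d n → E) (y : Dom d n) : E :=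
  ∫ ω, w ω • f (y - X ω) ∂μ

variable {μ : Measure Ω} {w : Ω → ℝ} {X : Ω → Dom d n}

lemma Periodic.sub {E : Type*} {f : Dom d n → E} (hp : Periodic f) (a : Dom d n) :
    Periodic fun y => f (y - a) := by
  intro y z
  simp only
  rw [← hp (y - a) z]
  congr 1
  ext i k
  simp only [Pi.sub_apply]; ring

lemma aestronglyMeasurable_avg {E : Type*} [NormedAddCommGroup E] [NormedSpace ℝ E]
    (hw : Integrable w μ) (hX : Measurable X) {f : Dom d n → E} (hf : Continuous f) (y : Dom d n) :
    AEStronglyMeasurable (fun ω => w ω • f (y - X ω)) μ :=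
  hw.aestronglyMeasurable.smul
    (hf.comp_aestronglyMeasurable (hX.const_sub y).aestronglyMeasurable)

lemma integrable_avg {E : Type*} [NormedAddCommGroup E] [NormedSpace ℝ E]
    (hw : Integrable w μ) (hX : Measurable X) {f : Dom d n → E} (hf : Continuous f)
    (hp : Periodic f) (y : Dom d n) : Integrable (fun ω => w ω • f (y - X ω)) μ := by
  obtain ⟨C, hC⟩ := hp.exists_bound hf
  refine (hw.norm.mul_const C).mono' (aestronglyMeasurable_avg hw hX hf y)
    (Filter.Eventually.of_forall fun ω => ?_)
  rw [norm_smul]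
  exact mul_le_mul_of_nonneg_left (hC _) (norm_nonneg _)

lemma periodic_avg {E : Type*} [NormedAddCommGroup E] [NormedSpace ℝ E] {f : Dom d n → E}
    (hp : Periodic f) : Periodic (avg μ w X f) := by
  intro y z
  unfold avg
  congr 1
  ext ω
  exact congrArg _ (hp.sub (X ω) y z)

lemma hasFDerivAt_avg {E : Type*} [NormedAddCommGroup E] [NormedSpace ℝ E]
    (hw : Integrable w μ) (hX : Measurable X) {f : Dom d n → E} (hf : ContDiff ℝ 1 f)
    (hp : Periodic f) (y : Dom d n) :
    HasFDerivAt (avg μ w X f) (avg μ w X (fderiv ℝ f) y) y := by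
  have hf' : Continuous (fderiv ℝ f) := hf.continuous_fderiv one_ne_zero
  obtain ⟨C, hC⟩ := hp.fderiv.exists_bound hf'
  refine hasFDerivAt_integral_of_dominated_of_fderiv_le (s := Set.univ)
    (F := fun y ω => w ω • f (y - X ω)) (F' := fun y ω => w ω • fderiv ℝ f (y - X ω))
    (bound := fun ω => ‖w ω‖ * C) Filter.univ_mem
    (Filter.Eventually.of_forall fun y => aestronglyMeasurable_avg hw hX hf.continuous y)
    (integrable_avg hw hX hf.continuous hp y) (aestronglyMeasurable_avg hw hX hf' y)
    (Filter.Eventually.of_forall fun ω y _ => ?_) (hw.norm.mul_const C)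
    (Filter.Eventually.of_forall fun ω y _ => ?_)
  · rw [norm_smul]
    exact mul_le_mul_of_nonneg_left (hC _) (norm_nonneg _)
  · have := (hf.differentiable one_ne_zero (y - X ω)).hasFDerivAt
    exact (this.comp y ((hasFDerivAt_id y).sub_const (X ω))).const_smul (w ω)

lemma contDiff_avg (hw : Integrable w μ) (hX : Measurable X) (m : ℕ) {E : Type}
    [NormedAddCommGroup E] [NormedSpace ℝ E] {f : Dom d n → E} (hf : ContDiff ℝ (⊤ : ℕ∞) f)
    (hp : Periodic f) : ContDiff ℝ m (avg μ w X f) := by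
  have hf1 {E : Type} [NormedAddCommGroup E] [NormedSpace ℝ E] {f : Dom d n → E}
      (hf : ContDiff ℝ (⊤ : ℕ∞) f) : ContDiff ℝ 1 f := hf.of_le (by exact_mod_cast le_top)
  induction m generalizing E with
  | zero =>
    rw [Nat.cast_zero, contDiff_zero, continuous_iff_continuousAt]
    exact fun y => (hasFDerivAt_avg hw hX (hf1 hf) hp y).continuousAt
  | succ m ih =>
    rw [Nat.cast_succ, contDiff_succ_iff_fderiv]
    refine ⟨fun y => (hasFDerivAt_avg hw hX (hf1 hf) hp y).differentiableAt, by simp, ?_⟩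
    have : fderiv ℝ (avg μ w X f) = avg μ w X (fderiv ℝ f) :=
      funext fun y => (hasFDerivAt_avg hw hX (hf1 hf) hp y).fderiv
    rw [this]
    exact ih (hf.fderiv_right (by simp)) hp.fderiv

lemma SmoothPeriodic.avg (hw : Integrable w μ) (hX : Measurable X) {f : Dom d n → ℝ}
    (hf : SmoothPeriodic f) : SmoothPeriodic (avg μ w X f) :=
  ⟨contDiff_infty.2 fun m => contDiff_avg hw hX m hf.smooth hf.periodic,
    periodic_avg hf.periodic⟩

lemma pd_avg (hw : Integrable w μ) (hX : Measurable X) {f : Dom d n → ℝ}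
    (hf : SmoothPeriodic f) (i : Fin n) (k : Fin d) : pd i k (avg μ w X f) =
      avg μ w X (pd i k f) := by
  ext y
  have hf1 : ContDiff ℝ 1 f := hf.smooth.of_le (by exact_mod_cast le_top)
  rw [pd, (hasFDerivAt_avg hw hX hf1 hf.periodic y).fderiv, avg,
    ContinuousLinearMap.integral_apply
      (integrable_avg hw hX (hf1.continuous_fderiv one_ne_zero) hf.periodic.fderiv y)]
  rfl

lemma pds_avg (hw : Integrable w μ) (hX : Measurable X) {f : Dom d n → ℝ}
    (hf : SmoothPeriodic f) (l : List (Fin n × Fin d)) : pds l (avg μ w X f) =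
      avg μ w X (pds l f) := by
  induction l with
  | nil => rfl
  | cons p l ih =>
    change pd p.1 p.2 (pds l _) = _
    rw [ih, pd_avg hw hX (hf.pds l)]
    rfl

lemma integrable_avg_prod [SFinite μ] (hw : Integrable w μ) (hX : Measurable X) {g : Dom d n → ℂ}
    (hg : Continuous g) {f : Dom d n → ℝ} (hf : Continuous f) (hp : Periodic f) :
    Integrable (fun p : Dom d n × Ω => g p.1 * ((w p.2 * f (p.1 - X p.2) : ℝ) : ℂ))
      ((volume.restrict (cell d n)).prod μ) := by
  obtain ⟨C, hC⟩ := hp.exists_bound hf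
  have hgi : Integrable g (volume.restrict (cell d n)) := hg.integrableOn_Icc
  refine ((hgi.norm.mul_prod hw.norm).mul_const C).mono' ?_
    (Filter.Eventually.of_forall fun p => ?_)
  · refine (hg.comp_aestronglyMeasurable measurable_fst.aestronglyMeasurable).mul ?_
    refine Complex.continuous_ofReal.comp_aestronglyMeasurable ?_
    refine (hw.aestronglyMeasurable.comp_snd).mul ?_
    refine hf.comp_aestronglyMeasurable ?_
    exact (measurable_fst.sub (hX.comp measurable_snd)).aestronglyMeasurable
  · rw [norm_mul, Complex.norm_real, norm_mul, ← mul_assoc]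
    exact mul_le_mul_of_nonneg_left (hC _) (by positivity)

lemma coeff_avg [SFinite μ] (hw : Integrable w μ) (hX : Measurable X) {f : Dom d n → ℝ}
    (hf : SmoothPeriodic f) (ν : Fin n × Fin d → ℤ) :
    coeff (avg μ w X f) ν = (∫ ω, (w ω : ℂ) * mode (-ν) (X ω) ∂μ) * coeff f ν := by
  have hfc := hf.continuous
  have h1 := integral_integral_swap (f := fun y ω => mode (-ν) y * ((w ω * f (y - X ω) : ℝ) : ℂ))
    (μ := (volume : Measure (Dom d n)).restrict (cell d n)) (ν := μ)
    (integrable_avg_prod hw hX (continuous_mode _) hfc hf.periodic)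
  have h2 : ∀ ω, ∫ y in cell d n, mode (-ν) y * ((w ω * f (y - X ω) : ℝ) : ℂ) =
      (w ω : ℂ) * mode (-ν) (X ω) * coeff f ν := fun ω => by
    have := coeff_translate hfc hf.periodic ν (-X ω)
    rw [← mode_neg_neg, neg_neg] at this
    rw [mul_assoc, ← this, coeff, ← integral_const_mul]
    congr 1; ext y
    push_cast
    rw [sub_eq_add_neg]; ring
  simp_rw [h2] at h1
  rw [integral_mul_const] at h1
  rw [← h1]
  unfold coeff avg
  congr 1; ext y
  rw [integral_const_mul, integral_complex_ofReal]
  rfl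

lemma sq_integral_mul_le {c : Ω → ℝ} {F : Ω → ℝ} (hc : ∀ ω, 0 ≤ c ω) (hi : Integrable c μ)
    (h1 : Integrable (fun ω => c ω * F ω) μ) (h2 : Integrable (fun ω => c ω * F ω ^ 2) μ) :
    (∫ ω, c ω * F ω ∂μ) ^ 2 ≤ (∫ ω, c ω ∂μ) * ∫ ω, c ω * F ω ^ 2 ∂μ := by
  have key : ∀ t : ℝ, 0 ≤ (∫ ω, c ω ∂μ) * (t * t) + (-2 * ∫ ω, c ω * F ω ∂μ) * t +
      ∫ ω, c ω * F ω ^ 2 ∂μ := fun t => by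
    have : 0 ≤ ∫ ω, c ω * (F ω - t) ^ 2 ∂μ :=
      integral_nonneg fun ω => mul_nonneg (hc ω) (sq_nonneg _)
    have e : (fun ω => c ω * (F ω - t) ^ 2) =
        fun ω => c ω * F ω ^ 2 - 2 * t * (c ω * F ω) + t * t * c ω := by ext ω; ring
    have h3 := integral_add (h2.sub (h1.const_mul (2 * t))) (hi.const_mul (t * t))
    simp only [Pi.sub_apply] at h3
    rw [e, h3, integral_sub h2 (h1.const_mul _), integral_const_mul, integral_const_mul] at this
    linarith
  have := discrim_le_zero key
  rw [discrim] at this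
  linarith

lemma integral_sq_sum_avg_le [SFinite μ] (hw : Integrable w μ) (hX : Measurable X) {ι : Type*}
    [Fintype ι] {f : ι → Dom d n → ℝ} (hf : ∀ i, Continuous (f i)) (hp : ∀ i, Periodic (f i))
    (hA : ∀ i, Continuous (avg μ w X (f i))) :
    ∫ y in cell d n, (∑ i, |avg μ w X (f i) y|) ^ 2 ≤
      (∫ ω, |w ω| ∂μ) ^ 2 * ∫ y in cell d n, (∑ i, |f i y|) ^ 2 := by
  set F : Dom d n → ℝ := fun y => ∑ i, |f i y| with hF
  have hFc : Continuous F := by fun_prop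
  have hFp : Periodic F := fun y z => Finset.sum_congr rfl fun i _ => by rw [hp i y z]
  have hF2p : Periodic fun y => F y ^ 2 := fun y z => by simp only [hFp y z]
  have hwa : Integrable (fun ω => |w ω|) μ := hw.abs
  have hpt : ∀ y, (∑ i, |avg μ w X (f i) y|) ^ 2 ≤
      (∫ ω, |w ω| ∂μ) * ∫ ω, |w ω| * F (y - X ω) ^ 2 ∂μ := fun y => by
    refine le_trans (pow_le_pow_left₀ (Finset.sum_nonneg fun i _ => abs_nonneg _) ?_ 2)
      (sq_integral_mul_le (F := fun ω => F (y - X ω)) (fun ω => abs_nonneg _) hwa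
        (integrable_avg hwa hX hFc hFp y)
        (integrable_avg hwa hX (hFc.pow 2) hF2p y))
    have : ∀ i, |avg μ w X (f i) y| ≤ ∫ ω, |w ω| * |f i (y - X ω)| ∂μ := fun i => by
      unfold avg
      refine (abs_integral_le_integral_abs).trans_eq ?_
      simp_rw [smul_eq_mul, abs_mul]
    refine (Finset.sum_le_sum fun i _ => this i).trans_eq ?_
    rw [← integral_finsetSum]
    · simp_rw [hF, Finset.mul_sum]
    · intro i _
      exact integrable_avg (f := fun y => |f i y|) hwa hX (hf i).abs
        (fun y z => by simp only [hp i y z]) y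
  have hprod := (integrable_avg_prod (g := fun _ => 1) hwa hX continuous_const (hFc.pow 2) hF2p)
  have hprod' : Integrable (fun p : Dom d n × Ω => |w p.2| * F (p.1 - X p.2) ^ 2)
      ((volume.restrict (cell d n)).prod μ) := by
    simpa [← Complex.ofReal_pow] using hprod.re
  have h1 : Integrable (fun y => ∫ ω, |w ω| * F (y - X ω) ^ 2 ∂μ) (volume.restrict (cell d n)) :=
    hprod'.integral_prod_left
  have hl : IntegrableOn (fun y => (∑ i, |avg μ w X (f i) y|) ^ 2) (cell d n) :=
    Continuous.integrableOn_Icc (by fun_prop)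
  refine (integral_mono hl (h1.const_mul _) hpt).trans_eq ?_
  rw [integral_const_mul, sq, mul_assoc]
  congr 1
  rw [integral_integral_swap hprod', ← integral_mul_const]
  congr 1; ext ω
  rw [integral_const_mul]
  congr 1
  simp_rw [sub_eq_add_neg]
  exact integral_cell_add (f := fun y => F y ^ 2) (hFc.pow 2) hF2p _

lemma integral_sq_DAbs_avg_le [SFinite μ] (hw : Integrable w μ) (hX : Measurable X)
    {f : Dom d n → ℝ} (hf : SmoothPeriodic f) (ℓ : ℕ) :
    ∫ y in cell d n, DAbs ℓ (avg μ w X f) y ^ 2 ≤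
      (∫ ω, |w ω| ∂μ) ^ 2 * ∫ y in cell d n, DAbs ℓ f y ^ 2 := by
  simp_rw [DAbs_eq hf, DAbs_eq (hf.avg hw hX), pds_avg hw hX hf]
  exact integral_sq_sum_avg_le hw hX (fun i => (hf.pds _).continuous)
    (fun i => (hf.pds _).periodic) fun i => ((hf.pds _).avg hw hX).continuous

end Averaging

section Kernels

open scoped FourierTransform SchwartzMap RealInnerProductSpace ContDiff

variable {d n : ℕ}

/-- The shift of `(ℝ^d)^n` along which the directional gradient differentiates. -/
def shift (δ : Fin n → ℝ) (x : EuclideanSpace ℝ (Fin d)) : Dom d n := fun i k => (δ i)⁻¹ * x k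

/-- The frequency in `ℝ^d` seen by the directional gradient on the mode `ν`. -/
def freq (δ : Fin n → ℝ) (ν : Fin n × Fin d → ℤ) : EuclideanSpace ℝ (Fin d) :=
  WithLp.toLp 2 fun k => ∑ i, (δ i)⁻¹ * (ν (i, k) : ℝ)

lemma measurable_shift (δ : Fin n → ℝ) : Measurable (shift (d := d) δ) := by
  unfold shift; fun_prop

lemma mode_neg_shift (δ : Fin n → ℝ) (ν : Fin n × Fin d → ℤ) (x : EuclideanSpace ℝ (Fin d)) :
    mode (-ν) (shift δ x) = (𝐞 (-⟪x, freq δ ν⟫) : ℂ) := by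
  rw [mode, Real.fourierChar_apply]
  have : ∑ p : Fin n × Fin d, (((-ν) p : ℤ) : ℝ) * shift δ x p.1 p.2 = -⟪x, freq δ ν⟫ := by
    rw [Fintype.sum_prod_type, Finset.sum_comm, PiLp.inner_apply, ← Finset.sum_neg_distrib]
    refine Finset.sum_congr rfl fun k _ => ?_
    simp only [shift, freq, Pi.neg_apply, Int.cast_neg, RCLike.inner_apply, conj_trivial,
      Finset.sum_mul]
    rw [← Finset.sum_neg_distrib]
    exact Finset.sum_congr rfl fun i _ => by ring
  rw [this]
  push_cast; ring_nf

lemma exists_integrable_fourier_eq {φ : EuclideanSpace ℝ (Fin d) → ℝ} (hφ : ContDiff ℝ ∞ φ)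
    (hc : HasCompactSupport φ) (he : ∀ ξ, φ (-ξ) = φ ξ) :
    ∃ k : EuclideanSpace ℝ (Fin d) → ℝ, Integrable k ∧
      ∀ ξ, 𝓕 (fun x => (k x : ℂ)) ξ = φ ξ := by
  have hφ' : ContDiff ℝ ∞ (fun ξ => (φ ξ : ℂ)) := Complex.ofRealCLM.contDiff.comp hφ
  have hc' : HasCompactSupport (fun ξ => (φ ξ : ℂ)) :=
    hc.comp_left (g := fun x : ℝ => (x : ℂ)) Complex.ofReal_zero
  let Φ : 𝓢(EuclideanSpace ℝ (Fin d), ℂ) := hc'.toSchwartzMap hφ'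
  let K : 𝓢(EuclideanSpace ℝ (Fin d), ℂ) := 𝓕⁻ Φ
  have hK : ∀ x, ((K x).re : ℂ) = K x := fun x => by
    have h1 : K x = ∫ v, (𝐞 ⟪v, x⟫ : ℂ) * (φ v : ℂ) := by
      change (𝓕⁻ Φ) x = _
      rw [SchwartzMap.fourierInv_coe, Real.fourierInv_eq]
      rfl
    rw [← Complex.conj_eq_iff_re, h1, ← integral_conj, ← integral_neg_eq_self]
    congr 1; ext v
    rw [map_mul, Complex.conj_ofReal, he, inner_neg_left, Real.fourierChar_apply,
      Real.fourierChar_apply, ← Complex.exp_conj]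
    simp [-mul_eq_mul_right_iff, Complex.conj_ofNat]
  refine ⟨fun x => (K x).re, K.integrable.re, fun ξ => ?_⟩
  simp_rw [hK]
  have : 𝓕 K = Φ := FourierTransform.fourier_fourierInv_eq Φ
  have h2 := congrArg (fun f : 𝓢(EuclideanSpace ℝ (Fin d), ℂ) => f ξ) this
  simp only [SchwartzMap.fourier_coe] at h2
  exact h2

lemma integral_prod_fourierChar {ρ : Measure ℝ} [SFinite ρ] {a r : ℝ → ℝ} (ha : Integrable a ρ)
    (hr : Measurable r) {k : EuclideanSpace ℝ (Fin d) → ℝ} (hk : Integrable k)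
    (ξ : EuclideanSpace ℝ (Fin d)) :
    ∫ p : ℝ × EuclideanSpace ℝ (Fin d), ((a p.1 * k p.2 : ℝ) : ℂ) *
      (𝐞 (-⟪r p.1 • p.2, ξ⟫) : ℂ) ∂(ρ.prod volume) =
      ∫ t, (a t : ℂ) * 𝓕 (fun x => (k x : ℂ)) (r t • ξ) ∂ρ := by
  rw [integral_prod]
  · congr 1; ext t
    rw [Real.fourier_eq, ← integral_const_mul]
    congr 1; ext x
    rw [Circle.smul_def, smul_eq_mul, real_inner_smul_left, real_inner_smul_right]
    push_cast; ring
  · refine ((ha.mul_prod hk).norm).mono' ?_ (Filter.Eventually.of_forall fun p => ?_)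
    · refine (Complex.continuous_ofReal.comp_aestronglyMeasurable
        (ha.mul_prod hk).aestronglyMeasurable).mul ?_
      refine Measurable.aestronglyMeasurable ?_
      refine (by fun_prop : Continuous fun s : ℝ => (𝐞 s : ℂ)).measurable.comp ?_
      have : Measurable fun p : ℝ × EuclideanSpace ℝ (Fin d) => r p.1 • p.2 :=
        (hr.comp measurable_fst).smul measurable_snd
      fun_prop
    · rw [norm_mul, Circle.norm_coe, mul_one, Complex.norm_real]

lemma exists_cutoff_kernel (d : ℕ) : ∃ (θ : EuclideanSpace ℝ (Fin d) → ℝ)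
    (k b : EuclideanSpace ℝ (Fin d) → ℝ), Integrable k ∧ Integrable b ∧
      (∀ ξ, 0 ≤ θ ξ ∧ θ ξ ≤ 1) ∧ (∀ ξ, 1 / 2 ≤ ‖ξ‖ → θ ξ = 0) ∧
      (∀ ξ, 𝓕 (fun x => (k x : ℂ)) ξ = θ ξ) ∧
      ∀ ξ, (4 * π ^ 2 * ‖ξ‖ ^ 2 : ℝ) * (∫ t in Set.Ioc (0 : ℝ) 1,
        (t : ℂ) * 𝓕 (fun x => (b x : ℂ)) (t • ξ)) = 1 - (θ ξ : ℂ) := by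
  let θ : ContDiffBump (0 : EuclideanSpace ℝ (Fin d)) := ⟨1 / 4, 1 / 2, by norm_num, by norm_num⟩
  have hθ : ContDiff ℝ ∞ θ := θ.contDiff
  have hθd : Differentiable ℝ θ := hθ.differentiable (by simp)
  have hθ' : ContDiff ℝ ∞ (fderiv ℝ θ) := hθ.fderiv_right (by simp)
  let ψ : EuclideanSpace ℝ (Fin d) → ℝ := fun ξ => -(fderiv ℝ θ ξ ξ) / (4 * π ^ 2 * ‖ξ‖ ^ 2)
  have hψ : ContDiff ℝ ∞ ψ := by
    rw [contDiff_iff_contDiffAt]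
    intro ξ
    by_cases h0 : ξ = 0
    · subst h0
      have : ψ =ᶠ[nhds 0] fun _ => 0 := by
        filter_upwards [(θ.eventuallyEq_one).fderiv (𝕜 := ℝ)] with x hx
        simp only [ψ, hx]
        simp
      exact contDiffAt_const.congr_of_eventuallyEq this
    · refine ContDiffAt.div (hθ'.clm_apply contDiff_id).neg.contDiffAt
        (contDiff_const.mul (contDiff_norm_sq ℝ)).contDiffAt ?_
      have := norm_pos_iff.2 h0
      positivity
  have hψc : HasCompactSupport ψ := by
    refine (θ.hasCompactSupport.fderiv (𝕜 := ℝ)).mono fun ξ h => ?_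
    rw [Function.mem_support] at h ⊢
    intro h0
    simp [ψ, h0] at h
  have hψe : ∀ ξ, ψ (-ξ) = ψ ξ := fun ξ => by
    have h1 : (fun x => θ (-x)) = θ := funext fun x => θ.neg x
    have h2 : HasFDerivAt (fun x => θ (-x))
        ((fderiv ℝ θ (-ξ)).comp (-ContinuousLinearMap.id ℝ _)) ξ :=
      (hθd (-ξ)).hasFDerivAt.comp ξ (hasFDerivAt_id ξ).neg
    rw [h1] at h2
    simp only [ψ, norm_neg, h2.fderiv]
    simp
  obtain ⟨k, hk, hk'⟩ := exists_integrable_fourier_eq hθ θ.hasCompactSupport θ.neg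
  obtain ⟨b, hb, hb'⟩ := exists_integrable_fourier_eq hψ hψc hψe
  refine ⟨θ, k, b, hk, hb, fun ξ => ⟨θ.nonneg, θ.le_one⟩, fun ξ h => θ.zero_of_le_dist (by simpa),
    hk', fun ξ => ?_⟩
  have h1 : ∀ t ∈ Set.Ioc (0 : ℝ) 1, ((4 * π ^ 2 * ‖ξ‖ ^ 2 : ℝ) : ℂ) *
      ((t : ℂ) * 𝓕 (fun x => (b x : ℂ)) (t • ξ)) = ((-(fderiv ℝ θ (t • ξ) ξ) : ℝ) : ℂ) := by
    intro t ht
    rw [hb']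
    norm_cast
    by_cases h0 : ξ = 0
    · simp [h0]
    · have := norm_pos_iff.2 h0
      have ht0 := ht.1
      simp only [ψ, map_smul, norm_smul, smul_eq_mul, norm_eq_abs, mul_pow, sq_abs]
      field_simp
  rw [← integral_const_mul, setIntegral_congr_fun measurableSet_Ioc h1, integral_complex_ofReal,
    ← intervalIntegral.integral_of_le zero_le_one,
    intervalIntegral.integral_eq_sub_of_hasDerivAt (f := fun t => -θ (t • ξ))]
  · rw [one_smul, zero_smul, θ.eventuallyEq_one.eq_of_nhds]
    push_cast; simp; ring
  · intro t _
    have h2 : HasDerivAt (fun t : ℝ => t • ξ) ξ t := by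
      simpa using (hasDerivAt_id t).smul_const ξ
    exact ((hθd (t • ξ)).hasFDerivAt.comp_hasDerivAt t h2).neg
  · refine Continuous.intervalIntegrable ?_ _ _
    exact ((hθ'.continuous.comp (by fun_prop)).clm_apply continuous_const).neg

/-- The kernel of the resolvent `(τ² - Δ̂)⁻¹`, as a mixture of Gaussians. -/
lemma integral_resolvent {τ : ℝ} (hτ : 0 < τ) (ξ : EuclideanSpace ℝ (Fin d)) :
    ∫ t in Set.Ioi (0 : ℝ), (exp (-τ ^ 2 * t) : ℂ) *
      𝓕 (fun x : EuclideanSpace ℝ (Fin d) => ((exp (-π * ‖x‖ ^ 2) : ℝ) : ℂ))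
        (√(4 * π * t) • ξ) = ((4 * π ^ 2 * ‖ξ‖ ^ 2 + τ ^ 2)⁻¹ : ℝ) := by
  have h1 : ∀ t ∈ Set.Ioi (0 : ℝ), (exp (-τ ^ 2 * t) : ℂ) *
      𝓕 (fun x : EuclideanSpace ℝ (Fin d) => ((exp (-π * ‖x‖ ^ 2) : ℝ) : ℂ))
        (√(4 * π * t) • ξ) = ((exp (-(4 * π ^ 2 * ‖ξ‖ ^ 2 + τ ^ 2) * t) : ℝ) : ℂ) := by
    intro t ht
    have ht0 : 0 < t := ht
    have hg := fourier_gaussian_innerProductSpace (V := EuclideanSpace ℝ (Fin d)) (b := (π : ℂ))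
      (by simpa using pi_pos) (√(4 * π * t) • ξ)
    have hp : (π : ℂ) ≠ 0 := by exact_mod_cast pi_ne_zero
    push_cast
    rw [hg, div_self hp, Complex.one_cpow, one_mul, ← Complex.exp_add]
    congr 1
    have : ‖√(4 * π * t) • ξ‖ ^ 2 = 4 * π * t * ‖ξ‖ ^ 2 := by
      rw [norm_smul, mul_pow, norm_of_nonneg (sqrt_nonneg _), sq_sqrt (by positivity)]
    have this' : (‖√(4 * π * t) • ξ‖ : ℂ) ^ 2 = 4 * π * t * ‖ξ‖ ^ 2 := by exact_mod_cast this
    rw [this']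
    field_simp
    ring
  rw [setIntegral_congr_fun measurableSet_Ioi h1, integral_complex_ofReal]
  congr 1
  have hpos : 0 < 4 * π ^ 2 * ‖ξ‖ ^ 2 + τ ^ 2 := by positivity
  rw [integral_exp_mul_Ioi (by linarith), mul_zero, exp_zero, neg_div_neg_eq, one_div]

end Kernels

section Parametrix

open scoped FourierTransform

variable {d n : ℕ}

/-- Average over translates along the directional shift, with respect to dilates of a kernel. -/
def mix (ρ : Measure ℝ) (a r : ℝ → ℝ) (k : EuclideanSpace ℝ (Fin d) → ℝ) (δ : Fin n → ℝ)
    (f : Dom d n → ℝ) : Dom d n → ℝ :=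
  avg (ρ.prod volume) (fun p : ℝ × EuclideanSpace ℝ (Fin d) => a p.1 * k p.2)
    (fun p => shift δ (r p.1 • p.2)) f

section Mix

variable {ρ : Measure ℝ} {a r : ℝ → ℝ} {k : EuclideanSpace ℝ (Fin d) → ℝ}

lemma measurable_shift_smul (hr : Measurable r) (δ : Fin n → ℝ) :
    Measurable fun p : ℝ × EuclideanSpace ℝ (Fin d) => shift δ (r p.1 • p.2) :=
  (measurable_shift δ).comp ((hr.comp measurable_fst).smul measurable_snd)

lemma SmoothPeriodic.mix (ha : Integrable a ρ) (hr : Measurable r) (hk : Integrable k)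
    (δ : Fin n → ℝ) {f : Dom d n → ℝ} (hf : SmoothPeriodic f) :
    SmoothPeriodic (mix ρ a r k δ f) :=
  hf.avg (ha.mul_prod hk) (measurable_shift_smul hr δ)

lemma coeff_mix [SFinite ρ] (ha : Integrable a ρ) (hr : Measurable r) (hk : Integrable k)
    (δ : Fin n → ℝ) {f : Dom d n → ℝ} (hf : SmoothPeriodic f)
    (ν : Fin n × Fin d → ℤ) : coeff (mix ρ a r k δ f) ν =
    (∫ t, (a t : ℂ) * 𝓕 (fun x => (k x : ℂ)) (r t • freq δ ν) ∂ρ) * coeff f ν := by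
  rw [mix, coeff_avg (ha.mul_prod hk) (measurable_shift_smul hr δ) hf,
    ← integral_prod_fourierChar ha hr hk]
  simp_rw [mode_neg_shift]

lemma integral_sq_DAbs_mix_le [SFinite ρ] (ha : Integrable a ρ) (hr : Measurable r)
    (hk : Integrable k)
    (δ : Fin n → ℝ) {f : Dom d n → ℝ} (hf : SmoothPeriodic f)
    (ℓ : ℕ) : ∫ y in cell d n, DAbs ℓ (mix ρ a r k δ f) y ^ 2 ≤
    ((∫ t, |a t| ∂ρ) * ∫ x, |k x|) ^ 2 * ∫ y in cell d n, DAbs ℓ f y ^ 2 := by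
  refine (integral_sq_DAbs_avg_le (ha.mul_prod hk) (measurable_shift_smul hr δ) hf ℓ).trans_eq ?_
  simp_rw [abs_mul]
  rw [integral_prod_mul (fun t => |a t|) (fun x => |k x|)]

end Mix

lemma SmoothPeriodic.continuous_DAbs {f : Dom d n → ℝ} (hf : SmoothPeriodic f) (ℓ : ℕ) :
    Continuous (DAbs ℓ f) := by
  have : DAbs ℓ f = fun y => ∑ idx : Fin ℓ → Fin n × Fin d, |MS.pds (List.ofFn idx) f y| :=
    funext fun y => DAbs_eq hf ℓ y
  rw [this]
  exact continuous_finsetSum _ fun idx _ => (hf.pds _).continuous.abs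

lemma DAbs_add_le {f g : Dom d n → ℝ} (hf : SmoothPeriodic f) (hg : SmoothPeriodic g) (ℓ : ℕ)
    (y : Dom d n) : DAbs ℓ (fun y => f y + g y) y ≤ DAbs ℓ f y + DAbs ℓ g y := by
  rw [DAbs_eq hf, DAbs_eq hg, DAbs_eq (hf.add hg), ← Finset.sum_add_distrib]
  refine Finset.sum_le_sum fun idx _ => ?_
  rw [pds_add hf hg]
  exact abs_add_le _ _

lemma DAbs_const_mul {f : Dom d n → ℝ} (hf : SmoothPeriodic f) (c : ℝ) (ℓ : ℕ) (y : Dom d n) :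
    DAbs ℓ (fun y => c * f y) y = |c| * DAbs ℓ f y := by
  rw [DAbs_eq hf, DAbs_eq (hf.const_mul c), Finset.mul_sum]
  refine Finset.sum_congr rfl fun idx _ => ?_
  rw [pds_const_mul hf, abs_mul]

lemma DAbs_nonneg (ℓ : ℕ) (f : Dom d n → ℝ) (y : Dom d n) : 0 ≤ DAbs ℓ f y :=
  Finset.sum_nonneg fun _ _ => abs_nonneg _

lemma integrable_DAbs_sq {f : Dom d n → ℝ} (hf : SmoothPeriodic f) (ℓ : ℕ) :
    IntegrableOn (fun y => DAbs ℓ f y ^ 2) (cell d n) :=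
  Continuous.integrableOn_Icc ((hf.continuous_DAbs ℓ).pow 2)

/-- The resolvent of `-Δ̂`, split into a part bounded uniformly in `τ` and a part `V`
localised at low directional frequencies. -/
lemma exists_parametrix (d : ℕ) : ∃ (θ : EuclideanSpace ℝ (Fin d) → ℝ) (K : ℝ), 0 ≤ K ∧
    (∀ ξ, 0 ≤ θ ξ ∧ θ ξ ≤ 1) ∧ (∀ ξ, 1 / 2 ≤ ‖ξ‖ → θ ξ = 0) ∧
    ∀ (n : ℕ) (δ : Fin n → ℝ) (τ : ℝ), 0 < τ → ∀ G : Dom d n → ℝ, SmoothPeriodic G →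
    ∃ U V : Dom d n → ℝ, SmoothPeriodic U ∧ SmoothPeriodic V ∧
      (∀ ν, coeff U ν = ((4 * π ^ 2 * ‖freq δ ν‖ ^ 2 + τ ^ 2)⁻¹ : ℝ) * coeff G ν) ∧
      (∀ ν, coeff V ν =
        (θ (freq δ ν) * (4 * π ^ 2 * ‖freq δ ν‖ ^ 2 + τ ^ 2)⁻¹ : ℝ) * coeff G ν) ∧
      ∀ ℓ, ∫ y in cell d n, DAbs ℓ U y ^ 2 ≤
        K * (∫ y in cell d n, DAbs ℓ G y ^ 2) + 3 * ∫ y in cell d n, DAbs ℓ V y ^ 2 := by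
  obtain ⟨θ, k, b, hk, hb, h01, hsupp, hFk, hFb⟩ := exists_cutoff_kernel d
  let ρ : Measure ℝ := volume.restrict (Set.Ioc 0 1)
  have h1 : Integrable (fun _ : ℝ => (1 : ℝ)) ρ := integrable_const _
  have hid : Integrable (fun t : ℝ => t) ρ :=
    (continuous_id.integrableOn_Icc (a := (0 : ℝ)) (b := 1)).mono_set Set.Ioc_subset_Icc_self
  refine ⟨θ, 6 * ((∫ t, |t| ∂ρ) * ∫ x, |b x|) ^ 2, by positivity, h01, hsupp,
    fun n δ τ hτ G hG => ?_⟩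
  let ρ' : Measure ℝ := volume.restrict (Set.Ioi 0)
  have hτ2 : (-τ ^ 2) < 0 := by have := sq_pos_of_pos hτ; linarith
  have hexp : Integrable (fun t : ℝ => exp (-τ ^ 2 * t)) ρ' := integrableOn_exp_mul_Ioi hτ2 0
  have hsqrt : Measurable fun t : ℝ => √(4 * π * t) := by fun_prop
  let γ : EuclideanSpace ℝ (Fin d) → ℝ := fun x => exp (-π * ‖x‖ ^ 2)
  have hγ' : ∀ x, ((γ x : ℝ) : ℂ) = Complex.exp (-(π : ℂ) * ‖x‖ ^ 2) := fun x => by simp [γ]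
  have hγ : Integrable γ := by
    have := GaussianFourier.integrable_cexp_neg_mul_sq_norm_add (V := EuclideanSpace ℝ (Fin d))
      (b := (π : ℂ)) (by simpa using pi_pos) 0 0
    refine this.re.congr (Filter.Eventually.of_forall fun x => ?_)
    simp only [zero_mul, add_zero, ← hγ', RCLike.re_eq_complex_re, Complex.ofReal_re]
  have hγ1 : ∫ x, |γ x| = 1 := by
    have := GaussianFourier.integral_rexp_neg_mul_sq_norm (V := EuclideanSpace ℝ (Fin d)) pi_pos
    rw [div_self pi_ne_zero, one_rpow] at this
    simp only [γ, abs_exp, this]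
  have hexp1 : ∫ t, |exp (-τ ^ 2 * t)| ∂ρ' = (τ ^ 2)⁻¹ := by
    simp only [abs_exp, ρ']
    rw [integral_exp_mul_Ioi hτ2, mul_zero, exp_zero, neg_div_neg_eq, one_div]
  let T := mix (n := n) ρ' (fun t => exp (-τ ^ 2 * t)) (fun t => √(4 * π * t)) γ δ
  let B := mix (n := n) ρ (fun t => t) (fun t => t) b δ
  let P := mix (n := n) ρ (fun _ => 1) (fun _ => 1) k δ
  have hT : ∀ {f}, SmoothPeriodic f → SmoothPeriodic (T f) := fun hf => hf.mix hexp hsqrt hγ δ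
  have hBG : SmoothPeriodic (B G) := hG.mix hid measurable_id hb δ
  have hPG : SmoothPeriodic (P G) := hG.mix h1 measurable_const hk δ
  have cT : ∀ {f}, SmoothPeriodic f → ∀ ν, coeff (T f) ν =
      ((4 * π ^ 2 * ‖freq δ ν‖ ^ 2 + τ ^ 2)⁻¹ : ℝ) * coeff f ν := fun hf ν => by
    rw [← integral_resolvent hτ]
    exact coeff_mix hexp hsqrt hγ δ hf ν
  have cP : ∀ ν, coeff (P G) ν = θ (freq δ ν) * coeff G ν := fun ν => by
    refine (coeff_mix h1 measurable_const hk δ hG ν).trans ?_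
    simp [hFk, ρ]
  have cB : ∀ ν, ((4 * π ^ 2 * ‖freq δ ν‖ ^ 2 : ℝ) : ℂ) * coeff (B G) ν =
      (1 - θ (freq δ ν)) * coeff G ν := fun ν => by
    rw [← hFb]
    exact (congrArg _ (coeff_mix hid measurable_id hb δ hG ν)).trans (mul_assoc _ _ _).symm
  have hτB := ((hT hBG).const_mul (-τ ^ 2))
  have hV := hT hPG
  have hsplit : T G = fun y => (B G y + -τ ^ 2 * T (B G) y) + T (P G) y := by
    refine eq_of_coeff_eq (hT hG) ((hBG.add hτB).add hV) fun ν => ?_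
    rw [coeff_add (hBG.add hτB).continuous hV.continuous,
      coeff_add hBG.continuous hτB.continuous, coeff_const_mul, cT hG, cT hBG, cT hPG, cP]
    have h := cB ν
    have hpos : 0 < 4 * π ^ 2 * ‖freq δ ν‖ ^ 2 + τ ^ 2 := by positivity
    set A := 4 * π ^ 2 * ‖freq δ ν‖ ^ 2
    have hne : (A : ℂ) + (τ : ℂ) ^ 2 ≠ 0 := by exact_mod_cast hpos.ne'
    push_cast
    field_simp
    linear_combination -h
  refine ⟨T G, T (P G), hT hG, hV, cT hG, fun ν => ?_, fun ℓ => ?_⟩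
  · rw [cT hPG, cP]; push_cast; ring
  have iB := integrable_DAbs_sq hBG ℓ
  have iT := integrable_DAbs_sq (hT hBG) ℓ
  have iV := integrable_DAbs_sq hV ℓ
  have iBT : IntegrableOn (fun y => 3 * DAbs ℓ (B G) y ^ 2 +
      3 * (τ ^ 2) ^ 2 * DAbs ℓ (T (B G)) y ^ 2) (cell d n) :=
    (iB.const_mul _).add (iT.const_mul _)
  have e1 : ∫ y in cell d n, DAbs ℓ (B G) y ^ 2 ≤ ((∫ t, |t| ∂ρ) * ∫ x, |b x|) ^ 2 *
      ∫ y in cell d n, DAbs ℓ G y ^ 2 := integral_sq_DAbs_mix_le hid measurable_id hb δ hG ℓ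
  have e2 : ∫ y in cell d n, DAbs ℓ (T (B G)) y ^ 2 ≤ ((τ ^ 2)⁻¹ * 1) ^ 2 *
      ∫ y in cell d n, DAbs ℓ (B G) y ^ 2 := by
    rw [← hexp1, ← hγ1]
    exact integral_sq_DAbs_mix_le hexp hsqrt hγ δ hBG ℓ
  have e3 : ∫ y in cell d n, DAbs ℓ (T G) y ^ 2 ≤ ∫ y in cell d n, (3 * DAbs ℓ (B G) y ^ 2 +
      3 * (τ ^ 2) ^ 2 * DAbs ℓ (T (B G)) y ^ 2 + 3 * DAbs ℓ (T (P G)) y ^ 2) := by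
    refine setIntegral_mono (integrable_DAbs_sq (hT hG) ℓ)
      (iBT.add (iV.const_mul _)) fun y => ?_
    have h := DAbs_add_le (hBG.add hτB) hV ℓ y
    have h' := DAbs_add_le hBG hτB ℓ y
    rw [← hsplit] at h
    rw [DAbs_const_mul (hT hBG), abs_neg, abs_of_nonneg (sq_nonneg τ)] at h'
    have h0 := DAbs_nonneg ℓ (T G) y
    have h2 := pow_le_pow_left₀ h0 (h.trans (add_le_add_left h' _)) 2
    simp only
    nlinarith [sq_nonneg (DAbs ℓ (B G) y - τ ^ 2 * DAbs ℓ (T (B G)) y),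
      sq_nonneg (DAbs ℓ (B G) y - DAbs ℓ (T (P G)) y),
      sq_nonneg (τ ^ 2 * DAbs ℓ (T (B G)) y - DAbs ℓ (T (P G)) y)]
  rw [integral_add iBT (iV.const_mul _),
    integral_add (iB.const_mul _) (iT.const_mul _), integral_const_mul, integral_const_mul,
    integral_const_mul] at e3
  have e4 : (τ ^ 2) ^ 2 * ∫ y in cell d n, DAbs ℓ (T (B G)) y ^ 2 ≤
      ∫ y in cell d n, DAbs ℓ (B G) y ^ 2 := by
    refine (mul_le_mul_of_nonneg_left e2 (by positivity)).trans_eq ?_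
    field_simp
  linarith

end Parametrix

section Resonance

variable {d n : ℕ}

/-- Nonzero modes of small directional frequency have a large component, of size at least the
scale separation ratio up to a constant. -/
lemma exists_le_abs_of_norm_freq_lt {δ : Fin n → ℝ} (hδ0 : ∀ i : Fin n, (i : ℕ) = 0 → δ i = 1)
    (hδ : ∀ i, 0 < δ i) (hanti : StrictAnti δ) {ν : Fin n × Fin d → ℤ} (hν : ν ≠ 0)
    (hfreq : ‖freq δ ν‖ < 1 / 2) : ∃ j : Fin n, 1 ≤ (j : ℕ) ∧ ∃ p,
      (2 * n * (δ j / δ ⟨j - 1, by omega⟩))⁻¹ ≤ |(ν p : ℝ)| := by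
  classical
  have hne : (Finset.univ.filter fun i : Fin n => ∃ k, ν (i, k) ≠ 0).Nonempty := by
    obtain ⟨p, hp⟩ := Function.ne_iff.1 hν
    exact ⟨p.1, by simpa using ⟨p.2, hp⟩⟩
  obtain ⟨j, hj, hmax⟩ := Finset.exists_max_image _ id hne
  simp only [Finset.mem_filter, Finset.mem_univ, true_and, id] at hj hmax
  obtain ⟨k, hk⟩ := hj
  have hzero : ∀ i, j < i → ν (i, k) = 0 := fun i hi => by
    by_contra h
    exact absurd (hmax i ⟨k, h⟩) (not_le.2 hi)
  have hn : (0 : ℝ) < n := by exact_mod_cast Fin.pos j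
  have hone : 1 ≤ |(ν (j, k) : ℝ)| := by exact_mod_cast Int.one_le_abs hk
  have hle1 : δ j ≤ 1 := by
    rw [← hδ0 ⟨0, Fin.pos j⟩ rfl]
    exact hanti.antitone (Fin.mk_le_of_le_val (Nat.zero_le _))
  have hinv : 1 ≤ (δ j)⁻¹ := (one_le_inv₀ (hδ j)).2 hle1
  have hcoord : |freq δ ν k| < 1 / 2 := (PiLp.norm_apply_le (freq δ ν) k).trans_lt hfreq
  have hsplit : freq δ ν k = (δ j)⁻¹ * ν (j, k) +
      ∑ i ∈ Finset.univ.erase j, (δ i)⁻¹ * (ν (i, k) : ℝ) :=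
    (Finset.add_sum_erase Finset.univ (fun i => (δ i)⁻¹ * (ν (i, k) : ℝ)) (Finset.mem_univ j)).symm
  have hmain : (δ j)⁻¹ ≤ |(δ j)⁻¹ * (ν (j, k) : ℝ)| := by
    rw [abs_mul, abs_of_pos (inv_pos.2 (hδ j))]
    exact le_mul_of_one_le_right (inv_pos.2 (hδ j)).le hone
  by_contra! hcon
  have hrest : ∀ i ∈ Finset.univ.erase j, |(δ i)⁻¹ * (ν (i, k) : ℝ)| ≤ (δ j)⁻¹ / (2 * n) := by
    intro i hi
    have hij := Finset.ne_of_mem_erase hi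
    have hpos := inv_pos.2 (hδ j)
    rcases lt_or_gt_of_ne hij with h | h
    · have hj1 : 1 ≤ (j : ℕ) := by have : (i : ℕ) < j := h; omega
      have h1 := (hcon j hj1 (i, k)).le
      have h2 : δ ⟨j - 1, by omega⟩ ≤ δ i :=
        hanti.antitone (by have : (i : ℕ) < j := h; rw [Fin.le_def]; simp only; omega)
      have h3 := hδ ⟨j - 1, by omega⟩
      rw [abs_mul, abs_of_pos (inv_pos.2 (hδ i))]
      calc (δ i)⁻¹ * |(ν (i, k) : ℝ)|
          ≤ (δ ⟨j - 1, by omega⟩)⁻¹ * (2 * n * (δ j / δ ⟨j - 1, by omega⟩))⁻¹ := by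
            gcongr
        _ = (δ j)⁻¹ / (2 * n) := by
            have := hδ j
            field_simp
    · rw [hzero i h]
      simp only [Int.cast_zero, mul_zero, abs_zero]
      positivity
  have hsum : |∑ i ∈ Finset.univ.erase j, (δ i)⁻¹ * (ν (i, k) : ℝ)| ≤ (δ j)⁻¹ / 2 := by
    refine (Finset.abs_sum_le_sum_abs _ _).trans ((Finset.sum_le_card_nsmul _ _ _ hrest).trans ?_)
    have hcard : (((Finset.univ : Finset (Fin n)).erase j).card : ℝ) ≤ n := by
      exact_mod_cast (Finset.card_erase_le).trans (by simp)
    rw [nsmul_eq_mul]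
    have hpos := inv_pos.2 (hδ j)
    calc _ ≤ n * ((δ j)⁻¹ / (2 * n)) := by gcongr
      _ = _ := by field_simp
  rw [hsplit] at hcoord
  have := abs_sub_abs_le_abs_add ((δ j)⁻¹ * (ν (j, k) : ℝ))
    (∑ i ∈ Finset.univ.erase j, (δ i)⁻¹ * (ν (i, k) : ℝ))
  linarith

/-- A function whose modes all have a large component is controlled by its high derivatives. -/
lemma integral_sq_pds_le {S : Type*} (s : Finset S) (N : S → ℝ) (e : S → ℕ) (M : ℝ)
    (hN : ∀ j ∈ s, 0 < N j) {V G : Dom d n → ℝ} (hV : SmoothPeriodic V) (hG : SmoothPeriodic G)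
    (hle : ∀ ν, ‖coeff V ν‖ ≤ M * ‖coeff G ν‖)
    (hres : ∀ ν, coeff V ν ≠ 0 → ∃ j ∈ s, ∃ p, N j ≤ |(ν p : ℝ)|) (l : List (Fin n × Fin d)) :
    ∫ y in cell d n, pds l V y ^ 2 ≤ M ^ 2 * ∑ j ∈ s, ∑ p, ((N j)⁻¹ ^ e j) ^ 2 *
      ∫ y in cell d n, pds (List.replicate (e j) p ++ l) G y ^ 2 := by
  have h1 := hasSum_coeff_sq (hV.pds l).continuous (hV.pds l).periodic
  have h2 := (hasSum_sum fun j (_ : j ∈ s) => hasSum_sum fun p (_ : p ∈ Finset.univ) =>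
    (hasSum_coeff_sq (hG.pds (List.replicate (e j) p ++ l)).continuous
      (hG.pds (List.replicate (e j) p ++ l)).periodic).mul_left (((N j)⁻¹ ^ e j) ^ 2)).mul_left
      (M ^ 2)
  refine hasSum_le (fun ν => ?_) h1 h2
  by_cases h0 : coeff V ν = 0
  · rw [coeff_pds hV, h0, mul_zero, norm_zero, zero_pow two_ne_zero]
    positivity
  obtain ⟨j, hj, p, hp⟩ := hres ν h0
  have hNj := hN j hj
  have key : ‖coeff (pds l V) ν‖ ≤
      M * ((N j)⁻¹ ^ e j * ‖coeff (pds (List.replicate (e j) p ++ l) G) ν‖) := by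
    rw [coeff_pds hV, coeff_pds hG, List.map_append, List.prod_append, List.map_replicate,
      List.prod_replicate]
    simp only [norm_mul, norm_pow]
    set A := ‖(l.map fun p => 2 * (π : ℂ) * Complex.I * (ν p : ℂ)).prod‖
    have hval : ‖(2 : ℂ)‖ * ‖(π : ℂ)‖ * ‖Complex.I‖ * ‖(ν p : ℂ)‖ = 2 * π * |(ν p : ℝ)| := by
      simp [abs_of_pos pi_pos]
    rw [hval]
    have h3 : 1 ≤ (N j)⁻¹ ^ e j * (2 * π * |(ν p : ℝ)|) ^ e j := by
      rw [← mul_pow]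
      refine one_le_pow₀ ?_
      rw [inv_mul_eq_div, one_le_div hNj]
      have := pi_gt_three
      nlinarith [abs_nonneg (ν p : ℝ)]
    have hA : 0 ≤ A := norm_nonneg _
    have h4 := mul_le_mul_of_nonneg_left (hle ν) hA
    have h5 : 0 ≤ A * (M * ‖coeff G ν‖) := mul_nonneg hA ((norm_nonneg _).trans (hle ν))
    calc A * ‖coeff V ν‖ ≤ A * (M * ‖coeff G ν‖) := h4
      _ ≤ A * (M * ‖coeff G ν‖) * ((N j)⁻¹ ^ e j * (2 * π * |(ν p : ℝ)|) ^ e j) :=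
        le_mul_of_one_le_right h5 h3
      _ = _ := by ring
  calc ‖coeff (pds l V) ν‖ ^ 2
      ≤ M ^ 2 * (((N j)⁻¹ ^ e j) ^ 2 *
        ‖coeff (pds (List.replicate (e j) p ++ l) G) ν‖ ^ 2) := by
        rw [← mul_pow, ← mul_pow]
        exact pow_le_pow_left₀ (norm_nonneg _) key 2
    _ ≤ _ := by
        gcongr
        refine le_trans ?_ (Finset.single_le_sum (fun i _ => Finset.sum_nonneg fun q _ => by
          positivity) hj)
        exact Finset.single_le_sum (f := fun q => ((N j)⁻¹ ^ e j) ^ 2 *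
          ‖coeff (pds (List.replicate (e j) q ++ l) G) ν‖ ^ 2) (fun q _ => by positivity)
          (Finset.mem_univ p)

lemma integral_sq_pds_le_DAbs {f : Dom d n → ℝ} (hf : SmoothPeriodic f)
    (l : List (Fin n × Fin d)) :
    ∫ y in cell d n, pds l f y ^ 2 ≤ ∫ y in cell d n, DAbs l.length f y ^ 2 := by
  refine setIntegral_mono (Continuous.integrableOn_Icc ((hf.pds l).continuous.pow 2))
    (integrable_DAbs_sq hf _) fun y => ?_
  simp only
  rw [← sq_abs]
  refine pow_le_pow_left₀ (abs_nonneg _) ?_ 2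
  rw [DAbs_eq hf]
  have := Finset.single_le_sum (f := fun idx : Fin l.length → Fin n × Fin d =>
    |pds (List.ofFn idx) f y|) (fun _ _ => abs_nonneg _) (Finset.mem_univ l.get)
  simpa using this

lemma integral_sq_DAbs_le {f : Dom d n → ℝ} (hf : SmoothPeriodic f) (ℓ : ℕ) {X : ℝ}
    (hX : ∀ l : List (Fin n × Fin d), l.length = ℓ → ∫ y in cell d n, pds l f y ^ 2 ≤ X) :
    ∫ y in cell d n, DAbs ℓ f y ^ 2 ≤ (((n * d : ℕ) : ℝ) ^ ℓ) ^ 2 * X := by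
  have hi : ∀ idx : Fin ℓ → Fin n × Fin d,
      IntegrableOn (fun y => pds (List.ofFn idx) f y ^ 2) (cell d n) := fun idx =>
    Continuous.integrableOn_Icc ((hf.pds _).continuous.pow 2)
  have hcard : ((Finset.univ : Finset (Fin ℓ → Fin n × Fin d)).card : ℝ) =
      ((n * d : ℕ) : ℝ) ^ ℓ := by
    simp
  calc ∫ y in cell d n, DAbs ℓ f y ^ 2
      ≤ ∫ y in cell d n, ((n * d : ℕ) : ℝ) ^ ℓ *
        ∑ idx : Fin ℓ → Fin n × Fin d, pds (List.ofFn idx) f y ^ 2 := by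
        refine setIntegral_mono (integrable_DAbs_sq hf ℓ)
          ((integrable_finsetSum _ fun idx _ => hi idx).const_mul _) fun y => ?_
        simp only
        rw [DAbs_eq hf, ← hcard]
        simpa only [sq_abs] using sq_sum_le_card_mul_sum_sq
          (s := (Finset.univ : Finset (Fin ℓ → Fin n × Fin d)))
          (f := fun idx => |pds (List.ofFn idx) f y|)
    _ = ((n * d : ℕ) : ℝ) ^ ℓ * ∑ idx : Fin ℓ → Fin n × Fin d,
        ∫ y in cell d n, pds (List.ofFn idx) f y ^ 2 := by
        rw [integral_const_mul, integral_finsetSum _ fun idx _ => hi idx]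
    _ ≤ ((n * d : ℕ) : ℝ) ^ ℓ * (((n * d : ℕ) : ℝ) ^ ℓ * X) := by
        gcongr
        rw [← hcard, ← nsmul_eq_mul]
        exact Finset.sum_le_card_nsmul _ _ _ fun idx _ => hX _ (List.length_ofFn)
    _ = _ := by ring

end Resonance

section Equation

variable {d n : ℕ}

lemma gradHatC_eq (δ : Fin n → ℝ) (k : Fin d) (u : Dom d n → ℝ) :
    gradHatC δ n k u = fun y => ∑ i, (δ i)⁻¹ * pd i k u y := by
  ext y
  simp [gradHatC]

lemma SmoothPeriodic.gradHatC {u : Dom d n → ℝ} (hu : SmoothPeriodic u) (δ : Fin n → ℝ)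
    (k : Fin d) : SmoothPeriodic (gradHatC δ n k u) := by
  rw [gradHatC_eq]
  exact .sum _ fun i _ => (hu.pd i k).const_mul _

lemma coeff_gradHatC {u : Dom d n → ℝ} (hu : SmoothPeriodic u) (δ : Fin n → ℝ) (k : Fin d)
    (ν : Fin n × Fin d → ℤ) :
    coeff (gradHatC δ n k u) ν = 2 * π * Complex.I * (freq δ ν k : ℝ) * coeff u ν := by
  rw [gradHatC_eq, coeff_sum _ fun i _ => ((hu.pd i k).const_mul _).continuous]
  simp only [coeff_const_mul, freq]
  push_cast
  rw [Finset.mul_sum, Finset.sum_mul]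
  refine Finset.sum_congr rfl fun i _ => ?_
  rw [coeff_pd hu (i, k)]
  ring

/-- The operator `-Δ̂ + τ²`. -/
def massiveOp (δ : Fin n → ℝ) (τ : ℝ) (u : Dom d n → ℝ) (y : Dom d n) : ℝ :=
  -(∑ k, gradHatC δ n k (fun y' => gradHatC δ n k u y') y) + τ ^ 2 * u y

lemma massiveOp_eq (δ : Fin n → ℝ) (τ : ℝ) (u : Dom d n → ℝ) : massiveOp δ τ u = fun y =>
    -1 * (∑ k, gradHatC δ n k (gradHatC δ n k u) y) + τ ^ 2 * u y := by
  ext y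
  rw [massiveOp, neg_one_mul]

lemma SmoothPeriodic.massiveOp {u : Dom d n → ℝ} (hu : SmoothPeriodic u) (δ : Fin n → ℝ)
    (τ : ℝ) : SmoothPeriodic (massiveOp δ τ u) := by
  rw [massiveOp_eq]
  exact ((SmoothPeriodic.sum _ fun k _ => (hu.gradHatC δ k).gradHatC δ k).const_mul _).add
    (hu.const_mul _)

lemma coeff_massiveOp {u : Dom d n → ℝ} (hu : SmoothPeriodic u) (δ : Fin n → ℝ) (τ : ℝ)
    (ν : Fin n × Fin d → ℤ) : coeff (massiveOp δ τ u) ν =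
      ((4 * π ^ 2 * ‖freq δ ν‖ ^ 2 + τ ^ 2 : ℝ) : ℂ) * coeff u ν := by
  have h1 := SmoothPeriodic.sum Finset.univ fun k _ => (hu.gradHatC δ k).gradHatC δ k
  rw [massiveOp_eq, coeff_add (h1.const_mul _).continuous (hu.const_mul _).continuous,
    coeff_const_mul, coeff_const_mul,
    coeff_sum _ fun k _ => ((hu.gradHatC δ k).gradHatC δ k).continuous]
  simp only [coeff_gradHatC (hu.gradHatC δ _), coeff_gradHatC hu]
  simp only [EuclideanSpace.norm_sq_eq, norm_eq_abs, sq_abs, Finset.mul_sum]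
  push_cast
  rw [add_mul, Finset.sum_mul]
  congr 1
  refine Finset.sum_congr rfl fun k _ => ?_
  linear_combination (-4 * (π : ℂ) ^ 2 * (freq δ ν k : ℂ) ^ 2 * coeff u ν) * Complex.I_sq

lemma eq_of_massiveOp_eq {δ : Fin n → ℝ} {τ : ℝ} (hτ : 0 < τ) {u v : Dom d n → ℝ}
    (hu : SmoothPeriodic u) (hv : SmoothPeriodic v) (h : massiveOp δ τ u = massiveOp δ τ v) :
    u = v := by
  refine eq_of_coeff_eq hu hv fun ν => ?_
  have hpos : 0 < 4 * π ^ 2 * ‖freq δ ν‖ ^ 2 + τ ^ 2 := by positivity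
  refine mul_left_cancel₀ (Complex.ofReal_ne_zero.2 hpos.ne') ?_
  rw [← coeff_massiveOp hu, ← coeff_massiveOp hv, h]

end Equation

section Estimate

variable {d n : ℕ}

lemma factorial_add_le (m e : ℕ) : ((m + e).factorial : ℝ) ≤ m.factorial * (m + e : ℝ) ^ e := by
  rw [← Nat.factorial_mul_ascFactorial]
  push_cast
  gcongr
  exact_mod_cast Nat.ascFactorial_le_pow_add m e

/-- The gain from the scale separation beats the growth of the derivatives. -/
lemma resonance_weight_le (hd : 1 ≤ d) (hn : 1 ≤ n) {r Λ τ : ℝ} (hr : 0 < r) (hΛ : 1 ≤ Λ)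
    {ℓ q k : ℕ}
    (h : r * (4 * n ^ 2 * d) * Λ * ((ℓ : ℝ) + k + q) ≤ (exp 1)⁻¹)
    (hk : exp (-(k : ℝ)) ≤ τ ^ 2) :
    ((n * d : ℕ) : ℝ) ^ ℓ * ((2 * n * r) ^ (ℓ + k) *
      (Λ ^ (ℓ + k + ℓ) * ((ℓ + k + ℓ + q).factorial : ℝ))) ≤
      τ ^ 2 * (Λ ^ ℓ * ((ℓ + q).factorial : ℝ)) := by
  have hn' : (1 : ℝ) ≤ n := by exact_mod_cast hn
  have hd' : (1 : ℝ) ≤ d := by exact_mod_cast hd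
  have hnd : (1 : ℝ) ≤ (n * d : ℕ) := by exact_mod_cast Nat.mul_pos hn hd
  have hfac := factorial_add_le (ℓ + q) (ℓ + k)
  have hidx : ℓ + q + (ℓ + k) = ℓ + k + ℓ + q := by ring
  rw [hidx] at hfac
  have hbase : (((ℓ + q : ℕ) : ℝ) + ((ℓ + k : ℕ) : ℝ)) ≤ 2 * ((ℓ : ℝ) + k + q) := by
    push_cast
    have : (0 : ℝ) ≤ k := k.cast_nonneg
    have : (0 : ℝ) ≤ q := q.cast_nonneg
    linarith
  have hsmall : ((n * d : ℕ) : ℝ) * (2 * n * r * Λ * (2 * ((ℓ : ℝ) + k + q))) ≤ (exp 1)⁻¹ := by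
    refine le_trans (le_of_eq ?_) h
    push_cast
    ring
  have hpow : ((n * d : ℕ) : ℝ) ^ (ℓ + k) * (2 * n * r * Λ * (2 * ((ℓ : ℝ) + k + q))) ^ (ℓ + k) ≤
      τ ^ 2 := by
    rw [← mul_pow]
    calc _ ≤ (exp 1)⁻¹ ^ (ℓ + k) := pow_le_pow_left₀ (by positivity) hsmall _
      _ ≤ (exp 1)⁻¹ ^ k := by
        refine pow_le_pow_of_le_one (by positivity) ?_ (by omega)
        exact inv_le_one_of_one_le₀ (one_le_exp zero_le_one)
      _ = exp (-(k : ℝ)) := by rw [← exp_neg, ← exp_nat_mul]; ring_nf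
      _ ≤ _ := hk
  calc ((n * d : ℕ) : ℝ) ^ ℓ * ((2 * n * r) ^ (ℓ + k) *
        (Λ ^ (ℓ + k + ℓ) * ((ℓ + k + ℓ + q).factorial : ℝ)))
      ≤ ((n * d : ℕ) : ℝ) ^ (ℓ + k) * ((2 * n * r) ^ (ℓ + k) *
        (Λ ^ (ℓ + k + ℓ) * (((ℓ + q).factorial : ℝ) * (2 * ((ℓ : ℝ) + k + q)) ^ (ℓ + k)))) := by
        gcongr
        · omega
        · refine hfac.trans ?_
          gcongr
    _ = (((n * d : ℕ) : ℝ) ^ (ℓ + k) *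
        (2 * n * r * Λ * (2 * ((ℓ : ℝ) + k + q))) ^ (ℓ + k)) *
        (Λ ^ ℓ * ((ℓ + q).factorial : ℝ)) := by
        rw [pow_add Λ, mul_pow _ (2 * ((ℓ : ℝ) + k + q)), mul_pow _ Λ]
        ring
    _ ≤ _ := by gcongr

lemma coeff_zero {f : Dom d n → ℝ} (hf : ∫ y in cell d n, f y = 0) : coeff f 0 = 0 := by
  have h : ∀ y : Dom d n, mode (-0) y = 1 := fun y => by simp [mode]
  simp only [coeff, h, one_mul]
  rw [integral_complex_ofReal, hf, Complex.ofReal_zero]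

/-- Bound on the part of the solution localised at low directional frequencies. -/
lemma integral_sq_DAbs_lowFreq_le (hd : 1 ≤ d) (hn : 1 ≤ n) {δ : Fin n → ℝ}
    (hδ0 : ∀ i : Fin n, (i : ℕ) = 0 → δ i = 1) (hδ : ∀ i, 0 < δ i) (hanti : StrictAnti δ)
    {Λ τ : ℝ} (hΛ : 1 ≤ Λ) (hτ : 0 < τ) {q ℓ : ℕ} {G V : Dom d n → ℝ} (hG : SmoothPeriodic G)
    (hV : SmoothPeriodic V) (hG0 : ∫ y in cell d n, G y = 0)
    (hGb : ∀ m, ∫ y in cell d n, DAbs m G y ^ 2 ≤ (Λ ^ m * ((m + q).factorial : ℝ)) ^ 2)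
    {θ : EuclideanSpace ℝ (Fin d) → ℝ} (hθ : ∀ ξ, 0 ≤ θ ξ ∧ θ ξ ≤ 1)
    (hθ0 : ∀ ξ, 1 / 2 ≤ ‖ξ‖ → θ ξ = 0)
    (hVG : ∀ ν, coeff V ν =
      (θ (freq δ ν) * (4 * π ^ 2 * ‖freq δ ν‖ ^ 2 + τ ^ 2)⁻¹ : ℝ) * coeff G ν)
    (hsep : ∀ j : Fin n, 1 ≤ (j : ℕ) → ∃ k : ℕ,
      δ j / δ ⟨j - 1, by omega⟩ * (4 * n ^ 2 * d) * Λ * ((ℓ : ℝ) + k + q) ≤ (exp 1)⁻¹ ∧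
      exp (-(k : ℝ)) ≤ τ ^ 2) :
    ∫ y in cell d n, DAbs ℓ V y ^ 2 ≤ (n * (n * d : ℕ)) * (Λ ^ ℓ * ((ℓ + q).factorial : ℝ)) ^ 2 := by
  classical
  choose! k hk using hsep
  set s := Finset.univ.filter fun j : Fin n => 1 ≤ (j : ℕ) with hs
  let r : Fin n → ℝ := fun j => δ j / δ ⟨j - 1, by omega⟩
  have hr : ∀ j, 0 < r j := fun j => div_pos (hδ _) (hδ _)
  have hn0 : (0 : ℝ) < n := by exact_mod_cast hn
  have hle : ∀ ν, ‖coeff V ν‖ ≤ (τ ^ 2)⁻¹ * ‖coeff G ν‖ := fun ν => by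
    rw [hVG, norm_mul]
    gcongr
    have hθν := hθ (freq δ ν)
    rw [Complex.norm_real, norm_of_nonneg (mul_nonneg hθν.1 (by positivity))]
    calc _ ≤ 1 * (τ ^ 2)⁻¹ := by
          gcongr
          · exact hθν.2
          · have : 0 ≤ 4 * π ^ 2 * ‖freq δ ν‖ ^ 2 := by positivity
            linarith
      _ = _ := one_mul _
  have hres : ∀ ν, coeff V ν ≠ 0 → ∃ j ∈ s, ∃ p, (2 * n * r j)⁻¹ ≤ |(ν p : ℝ)| := fun ν h => by
    have hν : ν ≠ 0 := by
      rintro rfl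
      exact h (by rw [hVG, coeff_zero hG0, mul_zero])
    have hfreq : ‖freq δ ν‖ < 1 / 2 := by
      by_contra! hge
      exact h (by rw [hVG, hθ0 _ hge]; simp)
    obtain ⟨j, hj, p, hp⟩ := exists_le_abs_of_norm_freq_lt hδ0 hδ hanti hν hfreq
    exact ⟨j, by simpa [hs] using hj, p, hp⟩
  have hX := fun (l : List (Fin n × Fin d)) (hl : l.length = ℓ) =>
    integral_sq_pds_le s (fun j => (2 * n * r j)⁻¹) (fun j => ℓ + k j) (τ ^ 2)⁻¹
      (fun j _ => by have := hr j; positivity) hV hG hle hres l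
  set D := Λ ^ ℓ * ((ℓ + q).factorial : ℝ)
  have hterm : ∀ (l : List (Fin n × Fin d)), l.length = ℓ → ∀ j ∈ s, ∀ p,
      (((n * d : ℕ) : ℝ) ^ ℓ) ^ 2 * ((τ ^ 2)⁻¹ ^ 2 * ((((2 * n * r j)⁻¹)⁻¹ ^ (ℓ + k j)) ^ 2 *
      ∫ y in cell d n, pds (List.replicate (ℓ + k j) p ++ l) G y ^ 2)) ≤ D ^ 2 := by
    intro l hl j hj p
    have hj1 : 1 ≤ (j : ℕ) := by simpa [hs] using hj
    have h1 := (integral_sq_pds_le_DAbs hG (List.replicate (ℓ + k j) p ++ l)).trans (hGb _)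
    rw [List.length_append, List.length_replicate, hl] at h1
    have h2 := resonance_weight_le hd hn (hr j) hΛ (hk j hj1).1 (hk j hj1).2
    have hrj := hr j
    have hτ2 : 0 < τ ^ 2 := by positivity
    rw [inv_inv]
    calc _ ≤ (((n * d : ℕ) : ℝ) ^ ℓ) ^ 2 * ((τ ^ 2)⁻¹ ^ 2 * (((2 * n * r j) ^ (ℓ + k j)) ^ 2 *
          (Λ ^ (ℓ + k j + ℓ) * ((ℓ + k j + ℓ + q).factorial : ℝ)) ^ 2)) := by gcongr
      _ = ((τ ^ 2)⁻¹ * (((n * d : ℕ) : ℝ) ^ ℓ * ((2 * n * r j) ^ (ℓ + k j) *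
          (Λ ^ (ℓ + k j + ℓ) * ((ℓ + k j + ℓ + q).factorial : ℝ))))) ^ 2 := by ring
      _ ≤ ((τ ^ 2)⁻¹ * (τ ^ 2 * D)) ^ 2 := by gcongr
      _ = D ^ 2 := by rw [inv_mul_cancel_left₀ hτ2.ne']
  have hd0 : (0 : ℝ) < d := by exact_mod_cast hd
  have hnd0 : 0 < (((n * d : ℕ) : ℝ) ^ ℓ) ^ 2 := by push_cast; positivity
  have hX' : ∀ l : List (Fin n × Fin d), l.length = ℓ → ∫ y in cell d n, pds l V y ^ 2 ≤
      ((((n * d : ℕ) : ℝ) ^ ℓ) ^ 2)⁻¹ * ((n * (n * d : ℕ)) * D ^ 2) := fun l hl => by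
    refine (hX l hl).trans ?_
    rw [le_inv_mul_iff₀ hnd0, Finset.mul_sum, Finset.mul_sum]
    simp only [Finset.mul_sum]
    have hs' : (s.card : ℝ) ≤ n := by exact_mod_cast (Finset.card_filter_le _ _).trans (by simp)
    calc _ ≤ ∑ j ∈ s, ∑ p : Fin n × Fin d, D ^ 2 :=
          Finset.sum_le_sum fun j hj => Finset.sum_le_sum fun p _ => hterm l hl j hj p
      _ = s.card * ((n * d : ℕ) : ℝ) * D ^ 2 := by
          simp only [Finset.sum_const, nsmul_eq_mul, Finset.card_univ, Fintype.card_prod,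
            Fintype.card_fin]
          ring
      _ ≤ _ := by gcongr
  exact (integral_sq_DAbs_le hV ℓ hX').trans_eq (mul_inv_cancel_left₀ hnd0.ne' _)

end Estimate

/-- Theorem 4.4: uniform estimate for the flux-corrector equation under weak scale
separation. -/
theorem statement9 (d n : ℕ) (hd : 1 ≤ d) (hn : 2 ≤ n) :
    ∃ C Ct Cn : ℝ, 1 ≤ C ∧ 1 ≤ Ct ∧ 1 ≤ Cn ∧
      ∀ (δ : Fin n → ℝ), δ ⟨0, by omega⟩ = 1 → (∀ i, 0 < δ i) →
        (∀ i j : Fin n, i < j → δ j < δ i) →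
      ∀ (Λ₁ : ℝ), 1 ≤ Λ₁ → ∀ (q : ℕ) (τ : ℝ), τ ∈ Set.Ioc (0 : ℝ) 1 →
      ∀ (G : Dom d n → ℝ),
        ContDiff ℝ (⊤ : ℕ∞) G → MPeriodic G →
        (∫ y in cell d n, G y) = 0 →
        (∀ ℓ : ℕ, L2 (DAbs ℓ G) ≤ Λ₁ ^ ℓ * (Nat.factorial (ℓ + q) : ℝ)) →
      ∀ ℓ : ℕ,
        (∀ j : ℕ, (hj2 : 2 ≤ j) → (hjn : j ≤ n) →
          ∃ kj : ℕ, 2 ≤ kj ∧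
            (δ ⟨j - 1, by omega⟩ / δ ⟨j - 2, by omega⟩) * C * Λ₁ * ((ℓ : ℝ) + kj + q)
                ≤ (Real.exp 1)⁻¹ ∧
            Ct * Real.exp (-(kj : ℝ)) ≤ τ ^ 2) →
        ∃ U : Dom d n → ℝ,
          (ContDiff ℝ (⊤ : ℕ∞) U ∧ MPeriodic U ∧
            (∀ y : Dom d n,
              -(∑ k, gradHatC δ n k (fun y' => gradHatC δ n k U y') y) + τ ^ 2 * U y = G y) ∧
            L2 (DAbs ℓ U) ≤ Cn * Λ₁ ^ ℓ * (Nat.factorial (ℓ + q) : ℝ)) ∧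
          (∀ U' : Dom d n → ℝ,
            ContDiff ℝ (⊤ : ℕ∞) U' → MPeriodic U' →
            (∀ y : Dom d n,
              -(∑ k, gradHatC δ n k (fun y' => gradHatC δ n k U' y') y)
                  + τ ^ 2 * U' y = G y) →
            U' = U) := by
  obtain ⟨θ, K, hK, hθ, hθ0, hpar⟩ := exists_parametrix d
  have hn1 : (1 : ℝ) ≤ n := by exact_mod_cast (by omega : 1 ≤ n)
  have hd1 : (1 : ℝ) ≤ d := by exact_mod_cast hd
  refine ⟨4 * n ^ 2 * d, 1, 1 + √(K + 3 * (n * (n * d : ℕ))), by nlinarith, le_rfl,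
    le_add_of_nonneg_right (sqrt_nonneg _), ?_⟩
  intro δ hδ1 hδ hanti Λ₁ hΛ q τ hτ G hGs hGp hG0 hGb ℓ hsep
  have hG : SmoothPeriodic G := ⟨hGs, hGp⟩
  obtain ⟨U, V, hU, hV, hUG, hVG, hUV⟩ := hpar n δ τ hτ.1 G hG
  have heq : massiveOp δ τ U = G := by
    refine eq_of_coeff_eq (hU.massiveOp δ τ) hG fun ν => ?_
    have hτ0 := hτ.1
    have hpos : 0 < 4 * π ^ 2 * ‖freq δ ν‖ ^ 2 + τ ^ 2 := by positivity
    rw [coeff_massiveOp hU, hUG, ← mul_assoc, ← Complex.ofReal_mul, mul_inv_cancel₀ hpos.ne',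
      Complex.ofReal_one, one_mul]
  refine ⟨U, ⟨hU.smooth, hU.periodic, congrFun heq, ?_⟩, fun U' hU's hU'p hU'eq =>
    eq_of_massiveOp_eq hτ.1 ⟨hU's, hU'p⟩ hU ((funext hU'eq).trans heq.symm)⟩
  have hGb' : ∀ m, ∫ y in cell d n, DAbs m G y ^ 2 ≤
      (Λ₁ ^ m * ((m + q).factorial : ℝ)) ^ 2 := fun m =>
    (sqrt_le_left (by positivity)).1 (hGb m)
  have hδ0 : ∀ i : Fin n, (i : ℕ) = 0 → δ i = 1 := fun i hi => by
    rw [← hδ1]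
    exact congrArg δ (Fin.ext hi)
  have hVb := integral_sq_DAbs_lowFreq_le hd (by omega) hδ0 hδ (fun i j h => hanti i j h) hΛ hτ.1
    (ℓ := ℓ) hG hV hG0 hGb' hθ hθ0 hVG fun j hj => by
      obtain ⟨k, -, h1, h2⟩ := hsep (j + 1) (by omega) (by omega)
      exact ⟨k, h1, by rwa [one_mul] at h2⟩
  set D := Λ₁ ^ ℓ * ((ℓ + q).factorial : ℝ) with hD
  have hD0 : 0 ≤ D := by positivity
  rw [mul_assoc, ← hD, L2]
  calc √(∫ y in cell d n, DAbs ℓ U y ^ 2)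
      ≤ √((K + 3 * (n * (n * d : ℕ))) * D ^ 2) := by
        refine sqrt_le_sqrt ((hUV ℓ).trans ?_)
        have := mul_le_mul_of_nonneg_left (hGb' ℓ) hK
        linarith
    _ = √(K + 3 * (n * (n * d : ℕ))) * D := by
        rw [sqrt_mul (by positivity), sqrt_sq hD0]
    _ ≤ (1 + √(K + 3 * (n * (n * d : ℕ)))) * D := by
        gcongr
        linarith

end MS
end
end

section
/- Uniform pointwise bounds on the multiscale flux correctors (Theorem 4.5): Let n ≥ 2, d ≥ 1, λ ∈ (0,1], C₀ ≥ 1, Λ₀ > 0, and let A : (ℝ^d)^n → ℝ^{d×d} be smooth, multiperiodic and λ-elliptic with ‖|D^ℓ A|‖_{L∞} ≤ C₀·Λ₀^ℓ·ℓ! for all ℓ ∈ ℕ. Then there exist constants C̃ ≥ 1, c > 0 and C ≥ 1, depending only on d, n, λ, C₀, Λ₀, such that the following holds. Let 1 ≥ ε₁ > ε₂ > ⋯ > εₙ > 0 satisfy ε_{j+1} ≤ C̃⁻¹·εⱼ for every 1 ≤ j ≤ n−1, set δᵢ = εᵢ/ε₁, and let τ ∈ (0,1] satisfy τ ≥ max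 over 1 ≤ i ≤ n−1 of e^{−c·εᵢ/ε_{i+1}}. Let 𝒳¹,…,𝒳^d : (ℝ^d)^n → ℝ be smooth multiperiodic functions solving −∇̂·(A ∇̂𝒳ʲ) + τ²·𝒳ʲ = ∇̂·(A eⱼ) pointwise for each j, let Ā ∈ ℝ^{d×d} have entries Āᵢⱼ = ⟨Aᵢⱼ + Σ_{k=1}^d Aᵢₖ·(∇̂𝒳ʲ)ₖ⟩, and let 𝒰 : (ℝ^d)^n → ℝ^{d×d} be smooth and multiperiodic with, entrywise, −Δ̂𝒰ᵢⱼ + τ²·𝒰ᵢⱼ = Āᵢⱼ − Aᵢⱼ − Σ_{k=1}^d Aᵢₖ·(∇̂𝒳ʲ)ₖ pointwise. Then ‖∇̂²𝒰‖_{L∞} + ‖∇̂𝒰‖_{L∞} + ‖𝒰‖_{L∞} ≤ C. -/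
open MeasureTheory Real

noncomputable section

namespace MS

/-- The algebra of smooth multiperiodic functions. -/
def smoothPer (d n : ℕ) : Subalgebra ℝ (Dom d n → ℝ) where
  carrier := {u | ContDiff ℝ (⊤ : ℕ∞) u ∧ MPeriodic u}
  mul_mem' := fun ha hb => ⟨ha.1.mul hb.1, fun y z => by
    simp only [Pi.mul_apply, ha.2 y z, hb.2 y z]⟩
  add_mem' := fun ha hb => ⟨ha.1.add hb.1, fun y z => by
    simp only [Pi.add_apply, ha.2 y z, hb.2 y z]⟩
  algebraMap_mem' := fun _ => ⟨contDiff_const, fun _ _ => rfl⟩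

/-- Smooth multiperiodic functions, as a type. -/
abbrev SP (d n : ℕ) := ↥(smoothPer d n)

section Auxiliary

variable {d n : ℕ}

instance : CoeFun (SP d n) (fun _ => Dom d n → ℝ) := ⟨fun u => u.1⟩

/-- The coordinate direction of `y_i^k`, where `p = (i, k)`. -/
def dir (p : Fin n × Fin d) : Dom d n := Pi.single p.1 (Pi.single p.2 1)

namespace SP

@[ext] lemma ext {u v : SP d n} (h : ∀ y, u y = v y) : u = v := Subtype.ext (funext h)

@[simp] lemma add_apply (u v : SP d n) (y : Dom d n) : (u + v) y = u y + v y := rfl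
@[simp] lemma sub_apply (u v : SP d n) (y : Dom d n) : (u - v) y = u y - v y := rfl
@[simp] lemma neg_apply (u : SP d n) (y : Dom d n) : (-u) y = -u y := rfl
@[simp] lemma mul_apply (u v : SP d n) (y : Dom d n) : (u * v) y = u y * v y := rfl
@[simp] lemma smul_apply (c : ℝ) (u : SP d n) (y : Dom d n) : (c • u) y = c * u y := rfl
@[simp] lemma one_apply (y : Dom d n) : (1 : SP d n) y = 1 := rfl
@[simp] lemma zero_apply (y : Dom d n) : (0 : SP d n) y = 0 := rfl

@[simp] lemma sum_apply {ι : Type*} (s : Finset ι) (u : ι → SP d n) (y : Dom d n) :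
    (∑ i ∈ s, u i) y = ∑ i ∈ s, u i y := by
  simp

lemma contDiff (u : SP d n) : ContDiff ℝ (⊤ : ℕ∞) u := u.2.1

lemma differentiable (u : SP d n) : Differentiable ℝ u :=
  u.contDiff.differentiable (by simp)

lemma continuous (u : SP d n) : Continuous u := u.contDiff.continuous

end SP

lemma contDiff_pd {u : Dom d n → ℝ} (hu : ContDiff ℝ (⊤ : ℕ∞) u) (i : Fin n) (k : Fin d) :
    ContDiff ℝ (⊤ : ℕ∞) (pd i k u) :=
  (hu.fderiv_right (m := (⊤ : ℕ∞)) (by simp)).clm_apply contDiff_const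

lemma mPeriodic_pd {u : Dom d n → ℝ} (hu : MPeriodic u) (i : Fin n) (k : Fin d) :
    MPeriodic (pd i k u) := by
  intro y z
  have h : (fun x : Dom d n => u (x + fun i k => (z i k : ℝ))) = u := funext fun x => hu x z
  have h2 := fderiv_comp_add_right (𝕜 := ℝ) (f := u) (x := y) (fun i k => (z i k : ℝ))
  rw [h] at h2
  unfold pd
  rw [h2]
  rfl

/-- Partial derivatives of smooth multiperiodic functions. -/
def D (p : Fin n × Fin d) : SP d n →ₗ[ℝ] SP d n where
  toFun u := ⟨pd p.1 p.2 u, contDiff_pd u.2.1 _ _, mPeriodic_pd u.2.2 _ _⟩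
  map_add' u v := by
    ext y
    exact congrArg (· (dir p)) (fderiv_add (u.differentiable y) (v.differentiable y))
  map_smul' c u := by
    ext y
    exact congrArg (· (dir p)) (fderiv_const_smul (u.differentiable y) c)

lemma D_apply (p : Fin n × Fin d) (u : SP d n) (y : Dom d n) :
    D p u y = fderiv ℝ u y (dir p) := rfl

lemma D_mul (p : Fin n × Fin d) (u v : SP d n) : D p (u * v) = D p u * v + u * D p v := by
  ext y
  have := congrArg (· (dir p)) (fderiv_mul (u.differentiable y) (v.differentiable y))
  simp only [_root_.add_apply, _root_.smul_apply, smul_eq_mul] at this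
  simp only [SP.add_apply, SP.mul_apply, D_apply]
  rw [add_comm, mul_comm (fderiv ℝ u y _), ← this]
  rfl

lemma D_comm (p q : Fin n × Fin d) (u : SP d n) : D p (D q u) = D q (D p u) := by
  ext y
  have hd : DifferentiableAt ℝ (fderiv ℝ u) y :=
    ((u.contDiff.fderiv_right (m := (⊤ : ℕ∞)) (by simp)).differentiable (by simp)) y
  have key : ∀ p q : Fin n × Fin d,
      D p (D q u) y = fderiv ℝ (fderiv ℝ u) y (dir p) (dir q) := by
    intro p q
    rw [D_apply]
    change fderiv ℝ (fun x => fderiv ℝ u x (dir q)) y (dir p) = _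
    rw [fderiv_clm_apply hd (differentiableAt_const _)]
    simp
  rw [key, key]
  exact (u.contDiff.contDiffAt.isSymmSndFDerivAt
    (by simpa using WithTop.coe_le_coe.2 (le_top : (2 : ℕ∞) ≤ ⊤))).eq _ _

lemma D_pow_comm (p q : Fin n × Fin d) (ℓ : ℕ) (u : SP d n) :
    (D q ^ ℓ) (D p u) = D p ((D q ^ ℓ) u) := by
  have h : Commute (D q) (D p) := LinearMap.ext fun u => D_comm q p u
  exact congrArg (· u) (h.pow_left ℓ).eq

lemma D_pow_mul_antidiagonal (p : Fin n × Fin d) (ℓ : ℕ) (u v : SP d n) :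
    (D p ^ ℓ) (u * v) = ∑ ij ∈ Finset.HasAntidiagonal.antidiagonal ℓ,
      ℓ.choose ij.1 • ((D p ^ ij.1) u * (D p ^ ij.2) v) := by
  induction ℓ with
  | zero => simp
  | succ ℓ ih =>
    rw [Finset.sum_antidiagonal_choose_succ_nsmul
      (fun i j => (D p ^ i) u * (D p ^ j) v) ℓ, pow_succ', Module.End.mul_apply, ih, map_sum,
      ← Finset.sum_add_distrib]
    refine Finset.sum_congr rfl fun ij hij => ?_
    rw [map_nsmul, D_mul, pow_succ', pow_succ', Module.End.mul_apply, Module.End.mul_apply,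
      Nat.choose_symm_of_eq_add (Finset.HasAntidiagonal.mem_antidiagonal.1 hij).symm,
      nsmul_add, add_comm]

/-- Leibniz formula, with the term carrying all derivatives on the second factor singled out. -/
lemma D_pow_mul (p : Fin n × Fin d) (ℓ : ℕ) (u v : SP d n) :
    (D p ^ ℓ) (u * v) = u * (D p ^ ℓ) v + ∑ i ∈ Finset.range ℓ,
      (ℓ.choose (i + 1) : ℝ) • ((D p ^ (i + 1)) u * (D p ^ (ℓ - 1 - i)) v) := by
  rw [D_pow_mul_antidiagonal, Finset.Nat.sum_antidiagonal_eq_sum_range_succ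
    (fun i j => ℓ.choose i • ((D p ^ i) u * (D p ^ j) v)), Finset.sum_range_succ', add_comm]
  congr 1
  · simp
  · refine Finset.sum_congr rfl fun i _ => ?_
    rw [Nat.cast_smul_eq_nsmul, Nat.sub_add_eq, Nat.sub_right_comm]

lemma D_pow_apply (p : Fin n × Fin d) (ℓ : ℕ) (u : SP d n) (y : Dom d n) :
    (D p ^ ℓ) u y = iteratedFDeriv ℝ ℓ u y fun _ => dir p := by
  induction ℓ generalizing y with
  | zero => simp
  | succ ℓ ih =>
    rw [pow_succ', Module.End.mul_apply, D_apply, iteratedFDeriv_succ_apply_left,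
      show ((D p ^ ℓ) u : Dom d n → ℝ) = fun y => iteratedFDeriv ℝ ℓ u y fun _ => dir p
        from funext ih, fderiv_continuousMultilinear_apply_const_apply]
    · rfl
    · exact (u.contDiff.differentiable_iteratedFDeriv (by exact_mod_cast WithTop.coe_lt_top ℓ)) y

lemma abs_D_pow_le_DAbs (p : Fin n × Fin d) (ℓ : ℕ) (u : SP d n) (y : Dom d n) :
    |(D p ^ ℓ) u y| ≤ DAbs ℓ u y := by
  rw [D_pow_apply]
  exact Finset.single_le_sum (f := fun idx : Fin ℓ → Fin n × Fin d =>
    |iteratedFDeriv ℝ ℓ u y fun m => Pi.single (idx m).1 (Pi.single (idx m).2 1)|)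
    (fun _ _ => abs_nonneg _) (Finset.mem_univ fun _ => p)

lemma volume_preserving_curry (d n : ℕ) :
    MeasurePreserving (MeasurableEquiv.curry (Fin n) (Fin d) ℝ) := by
  refine ⟨MeasurableEquiv.measurable _, ?_⟩
  let e : (Fin n × Fin d → ℝ) ≃L[ℝ] Dom d n :=
    (LinearEquiv.curry ℝ ℝ (Fin n) (Fin d)).toContinuousLinearEquiv
  have he : ⇑(MeasurableEquiv.curry (Fin n) (Fin d) ℝ) = e := rfl
  have hh : (Measure.map e volume).IsAddHaarMeasure :=
    e.isAddHaarMeasure_map volume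
  have hv : (volume : Measure (Dom d n)).IsAddHaarMeasure :=
    Measure.pi.isAddHaarMeasure (α := fun _ : Fin n => Fin d → ℝ) fun _ => volume
  have hc := Measure.isAddLeftInvariant_eq_smul (Measure.map e volume) (volume : Measure (Dom d n))
  set c := Measure.addHaarScalarFactor (Measure.map e volume) (volume : Measure (Dom d n))
  have h1 : (volume : Measure (Dom d n)) (Set.Icc 0 1) = 1 := by
    rw [← Set.pi_univ_Icc, volume_pi_pi]
    refine Finset.prod_eq_one fun i _ => ?_
    rw [Real.volume_Icc_pi]
    simp
  have h2 : Measure.map e volume (Set.Icc 0 1) = 1 := by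
    rw [Measure.map_apply e.continuous.measurable measurableSet_Icc,
      show e ⁻¹' Set.Icc 0 1 = Set.Icc 0 1 by
        ext x
        simp [e, Pi.le_def, Function.curry], Real.volume_Icc_pi]
    simp
  rw [hc, Measure.smul_apply, h1, ENNReal.smul_def, smul_eq_mul, mul_one, ENNReal.coe_eq_one] at h2
  rw [he, hc, h2, one_smul]

/-- The half-open unit cube of `ι → ℝ` with lower corner `a`. -/
def cube {ι : Type*} (a : ι → ℝ) : Set (ι → ℝ) := {x | ∀ i, x i ∈ Set.Ioc (a i) (a i + 1)}

lemma setIntegral_cell {E : Type*} [NormedAddCommGroup E] [NormedSpace ℝ E] (f : Dom d n → E) :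
    ∫ y in cell d n, f y = ∫ x in cube (0 : Fin n × Fin d → ℝ), f (Function.curry x) := by
  rw [cell, ← (volume_preserving_curry d n).setIntegral_preimage_emb
    (MeasurableEquiv.measurableEmbedding _)]
  have h1 : (MeasurableEquiv.curry (Fin n) (Fin d) ℝ) ⁻¹' Set.Icc 0 1 = Set.Icc 0 1 := by
    ext x
    simp [Pi.le_def]
  have h2 : cube (0 : Fin n × Fin d → ℝ) = Set.univ.pi fun _ => Set.Ioc 0 1 := by
    ext x
    simp [cube, Set.mem_pi]
  rw [h1, h2]
  refine setIntegral_congr_set ?_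
  exact (Measure.univ_pi_Ioc_ae_eq_Icc (f := (0 : Fin n × Fin d → ℝ)) (g := 1)).symm

lemma exists_torus_lift {Y : Type*} [TopologicalSpace Y] {f : Dom d n → Y} (hf : Continuous f)
    (hp : ∀ (y : Dom d n) (z : Fin n → Fin d → ℤ), f (fun i k => y i k + (z i k : ℝ)) = f y) :
    ∃ g : C(UnitAddTorus (Fin n × Fin d), Y), ∀ y, g (toTorus y) = f y := by
  let q : (Fin n × Fin d → ℝ) → UnitAddTorus (Fin n × Fin d) := fun x p => (x p : UnitAddCircle)
  have hquot : IsOpenQuotientMap q :=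
    IsOpenQuotientMap.piMap fun _ => QuotientAddGroup.isOpenQuotientMap_mk
  let qc : C(Fin n × Fin d → ℝ, UnitAddTorus (Fin n × Fin d)) := ⟨q, hquot.continuous⟩
  let F : C(Fin n × Fin d → ℝ, Y) := ⟨fun x => f (Function.curry x), hf.comp (by
    unfold Function.curry; fun_prop)⟩
  have hfac : Function.FactorsThrough F qc := by
    intro x x' hxx
    have h : ∀ p, ∃ m : ℤ, x' p = x p + m := fun p => by
      have h0 : ((x' p - x p : ℝ) : UnitAddCircle) = 0 := by
        rw [AddCircle.coe_sub, sub_eq_zero]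
        exact (congrFun hxx p).symm
      obtain ⟨m, hm⟩ := AddCircle.coe_eq_zero_iff (1 : ℝ) |>.1 h0
      exact ⟨m, by rw [zsmul_eq_mul, mul_one] at hm; linarith⟩
    choose m hm using h
    change f (Function.curry x) = f (Function.curry x')
    rw [← hp (Function.curry x) (Function.curry m)]
    congr 1
    funext i k
    exact (hm (i, k)).symm
  exact ⟨hquot.isQuotientMap.lift (f := qc) F hfac, fun y => congrArg (· (Function.uncurry y))
    (hquot.isQuotientMap.lift_comp (f := qc) F hfac)⟩

lemma setIntegral_cube_eq (f : UnitAddTorus (Fin n × Fin d) → ℝ) (a : Fin n × Fin d → ℝ) :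
    ∫ x in cube a, f (fun p => (x p : UnitAddCircle))
      = ∫ x in cube (0 : Fin n × Fin d → ℝ), f (fun p => (x p : UnitAddCircle)) :=
  (UnitAddTorus.integral_preimage f a).symm.trans (UnitAddTorus.integral_preimage f 0)

lemma setIntegral_cell_translate {f : Dom d n → ℝ} (hf : Continuous f) (hp : MPeriodic f)
    (v : Dom d n) : ∫ y in cell d n, f (y + v) = ∫ y in cell d n, f y := by
  obtain ⟨g, hg⟩ := exists_torus_lift hf hp
  rw [setIntegral_cell, setIntegral_cell]
  have h0 : ∀ x : Fin n × Fin d → ℝ,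
      f (Function.curry x) = g (fun p => (x p : UnitAddCircle)) := fun x => (hg _).symm
  have h1 : ∀ x : Fin n × Fin d → ℝ, f (Function.curry x + v)
      = g (fun p => ((x + Function.uncurry v) p : UnitAddCircle)) := fun x => (hg _).symm
  simp only [h0, h1]
  rw [← setIntegral_cube_eq g (Function.uncurry v)]
  have hc : (fun x : Fin n × Fin d → ℝ => x + Function.uncurry v) ⁻¹' cube (Function.uncurry v)
      = cube (0 : Fin n × Fin d → ℝ) := by
    ext x
    simp only [cube, Set.mem_preimage, Set.mem_ofPred_eq, Set.mem_Ioc, Pi.add_apply, Pi.zero_apply]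
    refine forall_congr' fun p => ?_
    constructor <;> rintro ⟨h, h'⟩ <;> constructor <;> linarith
  rw [← hc]
  exact (measurePreserving_add_right volume (Function.uncurry v)).setIntegral_preimage_emb
    (measurableEmbedding_addRight _) (fun x => g (fun p => (x p : UnitAddCircle))) _

lemma isCompact_cell : IsCompact (cell d n) := isCompact_Icc

lemma integrableOn_cell {E : Type*} [NormedAddCommGroup E] {f : Dom d n → E}
    (hf : Continuous f) : IntegrableOn f (cell d n) :=
  hf.continuousOn.integrableOn_compact isCompact_cell

lemma volume_cell : volume.real (cell d n) = 1 := by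
  rw [cell, ← Set.pi_univ_Icc, Measure.real, volume_pi_pi, Finset.prod_eq_one]
  · simp
  · intro i _
    rw [Real.volume_Icc_pi]
    simp

/-- The mean over the unit cell. -/
def mean : SP d n →ₗ[ℝ] ℝ where
  toFun u := ∫ y in cell d n, u y
  map_add' u v := integral_add (integrableOn_cell u.continuous) (integrableOn_cell v.continuous)
  map_smul' c _ := integral_const_mul c _

lemma mean_apply (u : SP d n) : mean u = ∫ y in cell d n, u y := rfl

lemma mean_mono {u v : SP d n} (h : ∀ y, u y ≤ v y) : mean u ≤ mean v :=
  setIntegral_mono (integrableOn_cell u.continuous) (integrableOn_cell v.continuous) h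

lemma mean_one : mean (1 : SP d n) = 1 := by
  rw [mean_apply]
  simp only [SP.one_apply, integral_const, smul_eq_mul, mul_one]
  simpa using volume_cell

lemma mean_mul_self_nonneg (u : SP d n) : 0 ≤ mean (u * u) :=
  integral_nonneg fun y => mul_self_nonneg (u y)

lemma mean_D (p : Fin n × Fin d) (u : SP d n) : mean (D p u) = 0 := by
  let γ : ℝ → Dom d n → ℝ := fun t y => u (y + t • dir p)
  let γ' : ℝ → Dom d n → ℝ := fun t y => D p u (y + t • dir p)
  have hcont : Continuous fun q : ℝ × Dom d n => D p u (q.2 + q.1 • dir p) :=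
    (D p u).continuous.comp (by fun_prop)
  obtain ⟨B, hB⟩ := ((isCompact_closedBall (0 : ℝ) 1).prod
    (isCompact_cell (d := d) (n := n))).exists_bound_of_continuousOn hcont.continuousOn
  have h := hasDerivAt_integral_of_dominated_loc_of_deriv_le
    (μ := volume.restrict (cell d n)) (F := γ) (F' := γ') (x₀ := 0) (s := Metric.closedBall 0 1)
    (bound := fun _ => B)
    (Metric.closedBall_mem_nhds _ one_pos)
    (Filter.Eventually.of_forall fun t =>
      (u.continuous.comp (continuous_add_const _)).aestronglyMeasurable)
    (integrableOn_cell (u.continuous.comp (continuous_add_const _)))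
    ((D p u).continuous.comp (continuous_add_const _)).aestronglyMeasurable
    ?_ (integrableOn_cell continuous_const) ?_
  · have hconst : (fun t => ∫ y in cell d n, γ t y) = fun _ => ∫ y in cell d n, u y :=
      funext fun t => setIntegral_cell_translate u.continuous u.2.2 _
    have h2 := h.2
    rw [hconst] at h2
    have h3 := h2.unique (hasDerivAt_const _ _)
    simpa [γ', mean_apply] using h3
  · refine (ae_restrict_iff' isCompact_cell.measurableSet).2 (Filter.Eventually.of_forall ?_)
    intro y hy t ht
    exact hB (t, y) ⟨ht, hy⟩
  · refine Filter.Eventually.of_forall fun y t _ => ?_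
    have h1 : HasDerivAt (fun t : ℝ => y + t • dir p) (dir p) t := by
      simpa using ((hasDerivAt_id t).smul_const (dir p)).const_add y
    exact ((u.differentiable _).hasFDerivAt).comp_hasDerivAt t h1

lemma mean_mul_D (p : Fin n × Fin d) (u v : SP d n) : mean (u * D p v) = -mean (D p u * v) := by
  have h := mean_D p (u * v)
  rw [D_mul, map_add] at h
  linarith

/-- Cauchy-Schwarz, with a bounded weight. -/
lemma abs_mean_mul_le {a : SP d n} {B : ℝ} (ha : ∀ y, |a y| ≤ B) (u v : SP d n) :
    |mean (a * u * v)| ≤ B * √(mean (u * u)) * √(mean (v * v)) := by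
  have hB : 0 ≤ B := (abs_nonneg _).trans (ha 0)
  have hL : ∀ w : SP d n, MemLp w (ENNReal.ofReal 2) (volume.restrict (cell d n)) := fun w => by
    rw [ENNReal.ofReal_ofNat]
    exact (memLp_two_iff_integrable_sq w.continuous.aestronglyMeasurable).2
      (integrableOn_cell (w.continuous.pow 2))
  have h := integral_mul_norm_le_Lp_mul_Lq (Real.HolderConjugate.two_two) (hL u) (hL v)
  have hs : ∀ w : SP d n, (∫ y in cell d n, ‖w y‖ ^ (2 : ℝ)) ^ (1 / 2 : ℝ) = √(mean (w * w)) := by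
    intro w
    rw [Real.sqrt_eq_rpow, mean_apply]
    congr 2
    funext y
    rw [Real.rpow_two, Real.norm_eq_abs, sq_abs, sq, SP.mul_apply]
  rw [hs, hs] at h
  calc |mean (a * u * v)| ≤ ∫ y in cell d n, |(a * u * v) y| := abs_integral_le_integral_abs
    _ ≤ ∫ y in cell d n, B * (‖u y‖ * ‖v y‖) := by
        refine setIntegral_mono (integrableOn_cell (a * u * v).continuous.abs)
          (integrableOn_cell (continuous_const.mul (u.continuous.norm.mul v.continuous.norm)))
          fun y => ?_
        simp only [SP.mul_apply, abs_mul, Real.norm_eq_abs, mul_assoc]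
        exact mul_le_mul_of_nonneg_right (ha y) (by positivity)
    _ = B * ∫ y in cell d n, ‖u y‖ * ‖v y‖ := integral_const_mul _ _
    _ ≤ _ := by
        rw [mul_assoc]
        exact mul_le_mul_of_nonneg_left h hB

/-- The `L²` norm of a vector field. -/
def vecNorm (G : Fin d → SP d n) : ℝ := √(∑ k, mean (G k * G k))

lemma vecNorm_nonneg (G : Fin d → SP d n) : 0 ≤ vecNorm G := Real.sqrt_nonneg _

lemma sq_vecNorm (G : Fin d → SP d n) : vecNorm G ^ 2 = ∑ k, mean (G k * G k) :=
  Real.sq_sqrt (Finset.sum_nonneg fun k _ => mean_mul_self_nonneg (G k))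

lemma sqrt_mean_le_vecNorm (G : Fin d → SP d n) (k : Fin d) :
    √(mean (G k * G k)) ≤ vecNorm G :=
  Real.sqrt_le_sqrt (Finset.single_le_sum (f := fun k => mean (G k * G k))
    (fun k _ => mean_mul_self_nonneg (G k)) (Finset.mem_univ k))

/-- `u` has all its pure derivatives in direction `p` bounded by `C₀ Λ^ℓ ℓ!`. -/
def AnalyticBound (p : Fin n × Fin d) (C₀ Λ : ℝ) (u : SP d n) : Prop :=
  ∀ ℓ y, |(D p ^ ℓ) u y| ≤ C₀ * Λ ^ ℓ * ℓ.factorial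

lemma choose_mul_bounds {C₀ Λ K R : ℝ} {ℓ i : ℕ} (hi : i < ℓ) :
    (ℓ.choose (i + 1) : ℝ) * (C₀ * Λ ^ (i + 1) * (i + 1).factorial
      * (K * R ^ (ℓ - 1 - i) * (ℓ - 1 - i).factorial))
      = C₀ * ℓ.factorial * (K * Λ * (Λ ^ i * R ^ (ℓ - 1 - i))) := by
  have h : ((ℓ.choose (i + 1) * (i + 1).factorial * (ℓ - 1 - i).factorial : ℕ) : ℝ)
      = ℓ.factorial := by
    rw [show ℓ - 1 - i = ℓ - (i + 1) by omega, Nat.choose_mul_factorial_mul_factorial hi]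
  rw [← h]
  push_cast
  ring

lemma sum_geometric {Λ K : ℝ} (ℓ : ℕ) :
    ∑ i ∈ Finset.range ℓ, K * Λ * (Λ ^ i * (Λ * (1 + K)) ^ (ℓ - 1 - i))
      = (Λ * (1 + K)) ^ ℓ - Λ ^ ℓ := by
  have h := geom_sum₂_mul Λ (Λ * (1 + K)) ℓ
  rw [← Finset.mul_sum]
  linear_combination -h

section Energy

variable {p : Fin n × Fin d} {C₀ Λ : ℝ} {a : Fin d → Fin d → SP d n}
  {b G : Fin d → SP d n}

/-- The `ℓ`-th derivative of a product, without the term carrying all derivatives on the second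
factor, is controlled by lower derivatives of the second factor. -/
lemma abs_mean_leibniz_rest_le {u v : SP d n} {N : ℕ → ℝ} (hu : AnalyticBound p C₀ Λ u) {ℓ : ℕ}
    (hC₀ : 0 ≤ C₀) (hΛ : 0 ≤ Λ)
    (hN : ∀ m < ℓ, √(mean ((D p ^ m) v * (D p ^ m) v)) ≤ N m) (w : SP d n) :
    |mean ((∑ i ∈ Finset.range ℓ,
      (ℓ.choose (i + 1) : ℝ) • ((D p ^ (i + 1)) u * (D p ^ (ℓ - 1 - i)) v)) * w)|
      ≤ (∑ i ∈ Finset.range ℓ, (ℓ.choose (i + 1) : ℝ) * (C₀ * Λ ^ (i + 1) * (i + 1).factorial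
          * N (ℓ - 1 - i))) * √(mean (w * w)) := by
  rw [Finset.sum_mul, map_sum, Finset.sum_mul]
  refine (Finset.abs_sum_le_sum_abs _ _).trans (Finset.sum_le_sum fun i hi => ?_)
  rw [smul_mul_assoc, map_smul, smul_eq_mul, abs_mul, Nat.abs_cast,
    mul_assoc (ℓ.choose (i + 1) : ℝ)]
  refine mul_le_mul_of_nonneg_left ?_ (Nat.cast_nonneg _)
  refine (abs_mean_mul_le (hu (i + 1)) _ _).trans ?_
  have := hN (ℓ - 1 - i) (by have := Finset.mem_range.1 hi; omega)
  gcongr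

lemma abs_mean_rest_le {u v : SP d n} {K : ℝ} (hu : AnalyticBound p C₀ Λ u) {ℓ : ℕ}
    (hC₀ : 0 ≤ C₀) (hΛ : 0 ≤ Λ)
    (hN : ∀ m < ℓ, √(mean ((D p ^ m) v * (D p ^ m) v)) ≤ K * (Λ * (1 + K)) ^ m * m.factorial)
    (w : SP d n) :
    |mean ((∑ i ∈ Finset.range ℓ,
      (ℓ.choose (i + 1) : ℝ) • ((D p ^ (i + 1)) u * (D p ^ (ℓ - 1 - i)) v)) * w)|
      ≤ C₀ * ℓ.factorial * ((Λ * (1 + K)) ^ ℓ - Λ ^ ℓ) * √(mean (w * w)) := by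
  refine (abs_mean_leibniz_rest_le hu hC₀ hΛ hN w).trans (le_of_eq ?_)
  rw [Finset.sum_congr rfl fun i hi => choose_mul_bounds (Finset.mem_range.1 hi), ← Finset.mul_sum,
    sum_geometric]

lemma abs_mean_le_of_bound {u : SP d n} {B : ℝ} (hu : ∀ y, |u y| ≤ B) (w : SP d n) :
    |mean (u * w)| ≤ B * √(mean (w * w)) := by
  have h := abs_mean_mul_le hu 1 w
  rwa [mul_one, mul_one, mean_one, Real.sqrt_one, mul_one] at h

/-- Analytic energy estimate: `L²` bounds on all pure derivatives of a gradient field `G` whose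
flux `b + a G` has derivatives pairing nonpositively with those of `G`. -/
lemma vecNorm_D_pow_le {lam : ℝ} (hlam : 0 < lam) (hC₀ : 0 ≤ C₀) (hΛ : 0 ≤ Λ)
    (ha : ∀ k l, AnalyticBound p C₀ Λ (a k l)) (hb : ∀ k, AnalyticBound p C₀ Λ (b k))
    (hell : ∀ v : Fin d → SP d n,
      lam * ∑ k, mean (v k * v k) ≤ ∑ k, ∑ l, mean (a k l * v l * v k))
    (hweak : ∀ ℓ, ∑ k, mean ((D p ^ ℓ) (b k + ∑ l, a k l * G l) * (D p ^ ℓ) (G k)) ≤ 0)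
    {K : ℝ} (hK : (d + d ^ 2) * C₀ ≤ lam * K) (ℓ : ℕ) :
    vecNorm (fun k => (D p ^ ℓ) (G k)) ≤ K * (Λ * (1 + K)) ^ ℓ * ℓ.factorial := by
  have hK0 : 0 ≤ K := (mul_nonneg_iff_of_pos_left hlam).1 (le_trans (by positivity) hK)
  induction ℓ using Nat.strong_induction_on with
  | _ ℓ ih =>
    set N := vecNorm (fun k => (D p ^ ℓ) (G k)) with hN
    set R := Λ * (1 + K) with hR
    have hN0 : 0 ≤ N := vecNorm_nonneg _
    have hle : ∀ k, √(mean ((D p ^ ℓ) (G k) * (D p ^ ℓ) (G k))) ≤ N := fun k =>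
      sqrt_mean_le_vecNorm (fun k => (D p ^ ℓ) (G k)) k
    have hΛR : Λ ^ ℓ ≤ R ^ ℓ := pow_le_pow_left₀ hΛ (by rw [hR]; nlinarith) ℓ
    have hrest : ∀ k l, |mean ((∑ i ∈ Finset.range ℓ, (ℓ.choose (i + 1) : ℝ) •
        ((D p ^ (i + 1)) (a k l) * (D p ^ (ℓ - 1 - i)) (G l))) * (D p ^ ℓ) (G k))|
        ≤ C₀ * ℓ.factorial * (R ^ ℓ - Λ ^ ℓ) * N := fun k l =>
      (abs_mean_rest_le (ha k l) hC₀ hΛ (fun m hm =>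
        (sqrt_mean_le_vecNorm (fun k => (D p ^ m) (G k)) l).trans (ih m hm)) _).trans
      (mul_le_mul_of_nonneg_left (hle k) (by have := sub_nonneg.2 hΛR; positivity))
    have hbk : ∀ k, |mean ((D p ^ ℓ) (b k) * (D p ^ ℓ) (G k))| ≤ C₀ * Λ ^ ℓ * ℓ.factorial * N :=
      fun k => (abs_mean_le_of_bound (hb k ℓ) _).trans
        (mul_le_mul_of_nonneg_left (hle k) (by positivity))
    have hexp := hweak ℓ
    simp only [map_add, map_sum, D_pow_mul, add_mul, Finset.sum_mul, Finset.sum_add_distrib]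
      at hexp
    have h1 := hell fun k => (D p ^ ℓ) (G k)
    rw [← sq_vecNorm, ← hN] at h1
    have h2 : -(∑ k : Fin d, C₀ * Λ ^ ℓ * ℓ.factorial * N)
        ≤ ∑ k, mean ((D p ^ ℓ) (b k) * (D p ^ ℓ) (G k)) := by
      rw [← Finset.sum_neg_distrib]
      exact Finset.sum_le_sum fun k _ => (abs_le.1 (hbk k)).1
    have h3 : -(∑ k : Fin d, ∑ l : Fin d, C₀ * ℓ.factorial * (R ^ ℓ - Λ ^ ℓ) * N)
        ≤ ∑ k, ∑ l, mean ((∑ i ∈ Finset.range ℓ, (ℓ.choose (i + 1) : ℝ) •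
          ((D p ^ (i + 1)) (a k l) * (D p ^ (ℓ - 1 - i)) (G l))) * (D p ^ ℓ) (G k)) := by
      rw [← Finset.sum_neg_distrib]
      refine Finset.sum_le_sum fun k _ => ?_
      rw [← Finset.sum_neg_distrib]
      exact Finset.sum_le_sum fun l _ => (abs_le.1 (hrest k l)).1
    simp only [Finset.sum_mul, map_sum] at h3
    simp only [Finset.sum_const, Finset.card_univ, Fintype.card_fin, nsmul_eq_mul] at h2 h3
    have h4 : lam * N ^ 2 ≤ lam * (K * R ^ ℓ * ℓ.factorial) * N := by
      have hs := sub_nonneg.2 hΛR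
      have h5 : (d : ℝ) * (C₀ * Λ ^ ℓ * ℓ.factorial * N)
          + d * (d * (C₀ * ℓ.factorial * (R ^ ℓ - Λ ^ ℓ) * N))
          ≤ (d + d ^ 2) * C₀ * (R ^ ℓ * ℓ.factorial * N) := by
        have h6 : (d + d ^ 2) * C₀ * (R ^ ℓ * ℓ.factorial * N)
          - ((d : ℝ) * (C₀ * Λ ^ ℓ * ℓ.factorial * N)
          + d * (d * (C₀ * ℓ.factorial * (R ^ ℓ - Λ ^ ℓ) * N)))
          = d * (C₀ * (R ^ ℓ - Λ ^ ℓ) * ℓ.factorial * N)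
            + d ^ 2 * (C₀ * Λ ^ ℓ * ℓ.factorial * N) := by ring
        have h7 : 0 ≤ d * (C₀ * (R ^ ℓ - Λ ^ ℓ) * ℓ.factorial * N)
            + d ^ 2 * (C₀ * Λ ^ ℓ * ℓ.factorial * N) := by positivity
        linarith
      have h8 : (d + d ^ 2) * C₀ * (R ^ ℓ * ℓ.factorial * N)
          ≤ lam * K * (R ^ ℓ * ℓ.factorial * N) :=
        mul_le_mul_of_nonneg_right hK (by positivity)
      linarith
    rcases hN0.eq_or_lt with h0 | h0
    · rw [← h0]
      positivity
    · have h9 : N * (lam * N) ≤ N * (lam * (K * R ^ ℓ * ℓ.factorial)) := by linarith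
      exact le_of_mul_le_mul_left (le_of_mul_le_mul_left h9 h0) hlam

/-- The derivatives of the flux, tested against a function of norm at most one. -/
lemma abs_mean_D_pow_flux_mul_le (hC₀ : 0 ≤ C₀) (hΛ : 0 ≤ Λ)
    (ha : ∀ k l, AnalyticBound p C₀ Λ (a k l)) (hb : ∀ k, AnalyticBound p C₀ Λ (b k))
    {K : ℝ} (hK : 0 ≤ K)
    (hG : ∀ ℓ, vecNorm (fun k => (D p ^ ℓ) (G k)) ≤ K * (Λ * (1 + K)) ^ ℓ * ℓ.factorial)
    {w : SP d n} (hw : mean (w * w) ≤ 1) (ℓ : ℕ) (k : Fin d) :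
    |mean ((D p ^ ℓ) (b k + ∑ l, a k l * G l) * w)|
      ≤ C₀ * (1 + d * (K + 1)) * (Λ * (1 + K)) ^ ℓ * ℓ.factorial := by
  set R := Λ * (1 + K) with hR
  have hΛR : Λ ^ ℓ ≤ R ^ ℓ := pow_le_pow_left₀ hΛ (by rw [hR]; nlinarith) ℓ
  have hs := sub_nonneg.2 hΛR
  have hw1 : √(mean (w * w)) ≤ 1 := Real.sqrt_le_one.2 hw
  have hG' : ∀ m l, √(mean ((D p ^ m) (G l) * (D p ^ m) (G l))) ≤ K * R ^ m * m.factorial :=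
    fun m l => (sqrt_mean_le_vecNorm (fun k => (D p ^ m) (G k)) l).trans (hG m)
  have h1 : |mean ((D p ^ ℓ) (b k) * w)| ≤ C₀ * R ^ ℓ * ℓ.factorial := by
    refine (abs_mean_le_of_bound (hb k ℓ) _).trans ?_
    refine (mul_le_of_le_one_right (by positivity) hw1).trans ?_
    gcongr
  have h2 : ∀ l, |mean ((D p ^ ℓ) (a k l * G l) * w)| ≤ C₀ * (K + 1) * R ^ ℓ * ℓ.factorial := by
    intro l
    rw [D_pow_mul, add_mul, map_add]
    have h3 : |mean (a k l * (D p ^ ℓ) (G l) * w)| ≤ C₀ * (K * R ^ ℓ * ℓ.factorial) := by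
      refine (abs_mean_mul_le (B := C₀) (fun y => by simpa using ha k l 0 y) _ _).trans ?_
      refine (mul_le_of_le_one_right (by positivity) hw1).trans ?_
      exact mul_le_mul_of_nonneg_left (hG' ℓ l) hC₀
    have h4 := abs_mean_rest_le (ha k l) hC₀ hΛ (ℓ := ℓ) (fun m _ => hG' m l) w
    have h5 : C₀ * ℓ.factorial * (R ^ ℓ - Λ ^ ℓ) * √(mean (w * w)) ≤ C₀ * ℓ.factorial * R ^ ℓ := by
      refine (mul_le_of_le_one_right (by positivity) hw1).trans ?_
      have : 0 ≤ Λ ^ ℓ := by positivity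
      exact mul_le_mul_of_nonneg_left (by linarith) (by positivity)
    refine (abs_add_le _ _).trans ((add_le_add h3 (h4.trans h5)).trans (le_of_eq (by ring)))
  rw [map_add, map_sum, add_mul, Finset.sum_mul, map_add, map_sum]
  refine (abs_add_le _ _).trans ((add_le_add h1 ((Finset.abs_sum_le_sum_abs _ _).trans
    (Finset.sum_le_sum fun l _ => h2 l))).trans (le_of_eq ?_))
  rw [Finset.sum_const, Finset.card_univ, Fintype.card_fin, nsmul_eq_mul]
  ring

end Energy

/-- The linear phase `2π k · y`. -/
def phase (k : Fin n × Fin d → ℤ) : Dom d n →L[ℝ] ℝ :=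
  ∑ p, (2 * π * k p) • (ContinuousLinearMap.proj (R := ℝ) (φ := fun _ : Fin d => ℝ) p.2).comp
    (ContinuousLinearMap.proj (R := ℝ) (φ := fun _ : Fin n => Fin d → ℝ) p.1)

lemma phase_apply (k : Fin n × Fin d → ℤ) (y : Dom d n) :
    phase k y = ∑ p, 2 * π * k p * y p.1 p.2 := by
  simp [phase]

lemma phase_dir (k : Fin n × Fin d → ℤ) (p : Fin n × Fin d) : phase k (dir p) = 2 * π * k p := by
  rw [phase_apply, Finset.sum_eq_single p]
  · simp [dir]
  · rintro ⟨i, l⟩ - h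
    by_cases hi : i = p.1
    · have hl : l ≠ p.2 := fun hl => h (Prod.ext hi hl)
      subst hi
      simp [dir, hl]
    · simp [dir, hi]
  · simp

lemma phase_translate (k : Fin n × Fin d → ℤ) (y : Dom d n) (z : Fin n → Fin d → ℤ) :
    phase k (fun i l => y i l + (z i l : ℝ))
      = phase k y + (∑ p, k p * z p.1 p.2 : ℤ) * (2 * π) := by
  simp only [phase_apply, Int.cast_sum, Int.cast_mul, Finset.sum_mul, ← Finset.sum_add_distrib]
  exact Finset.sum_congr rfl fun p _ => by ring

/-- The function `cos (2π k · y)`. -/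
def cosMode (k : Fin n × Fin d → ℤ) : SP d n :=
  ⟨fun y => Real.cos (phase k y), Real.contDiff_cos.comp (phase k).contDiff, fun y z => by
    beta_reduce
    rw [phase_translate, Real.cos_add_int_mul_two_pi]⟩

/-- The function `sin (2π k · y)`. -/
def sinMode (k : Fin n × Fin d → ℤ) : SP d n :=
  ⟨fun y => Real.sin (phase k y), Real.contDiff_sin.comp (phase k).contDiff, fun y z => by
    beta_reduce
    rw [phase_translate, Real.sin_add_int_mul_two_pi]⟩

lemma D_cosMode (p : Fin n × Fin d) (k : Fin n × Fin d → ℤ) :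
    D p (cosMode k) = (-(2 * π * k p)) • sinMode k := by
  ext y
  have h : HasFDerivAt (cosMode k : Dom d n → ℝ) _ y :=
    (Real.hasDerivAt_cos (phase k y)).comp_hasFDerivAt y (phase k).hasFDerivAt
  rw [D_apply, h.fderiv]
  simp only [_root_.smul_apply, phase_dir, SP.smul_apply, smul_eq_mul]
  change -Real.sin _ * _ = _ * Real.sin _
  ring

lemma D_sinMode (p : Fin n × Fin d) (k : Fin n × Fin d → ℤ) :
    D p (sinMode k) = (2 * π * k p) • cosMode k := by
  ext y
  have h : HasFDerivAt (sinMode k : Dom d n → ℝ) _ y :=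
    (Real.hasDerivAt_sin (phase k y)).comp_hasFDerivAt y (phase k).hasFDerivAt
  rw [D_apply, h.fderiv]
  simp only [_root_.smul_apply, phase_dir, SP.smul_apply, smul_eq_mul]
  change Real.cos _ * _ = _ * Real.cos _
  ring

lemma mean_mul_self_le_one {w : SP d n} (hw : ∀ y, |w y| ≤ 1) : mean (w * w) ≤ 1 := by
  rw [← mean_one (d := d) (n := n)]
  exact mean_mono fun y => by
    rw [SP.mul_apply, SP.one_apply, ← abs_mul_abs_self]
    exact mul_le_one₀ (hw y) (abs_nonneg _) (hw y)

lemma mean_cosMode_sq (k : Fin n × Fin d → ℤ) : mean (cosMode k * cosMode k) ≤ 1 :=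
  mean_mul_self_le_one fun _ => Real.abs_cos_le_one _

lemma mean_sinMode_sq (k : Fin n × Fin d → ℤ) : mean (sinMode k * sinMode k) ≤ 1 :=
  mean_mul_self_le_one fun _ => Real.abs_sin_le_one _

/-- Fourier coefficients over the unit cell. -/
def four (k : Fin n × Fin d → ℤ) : SP d n →ₗ[ℝ] ℂ where
  toFun u := mean (u * cosMode k) - mean (u * sinMode k) * Complex.I
  map_add' u v := by
    simp only [add_mul, map_add, Complex.ofReal_add]
    ring
  map_smul' c u := by
    simp only [smul_mul_assoc, map_smul, smul_eq_mul, Complex.ofReal_mul, RingHom.id_apply,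
      Complex.real_smul]
    ring

lemma four_apply (k : Fin n × Fin d → ℤ) (u : SP d n) :
    four k u = mean (u * cosMode k) - mean (u * sinMode k) * Complex.I := rfl

lemma norm_four_le (k : Fin n × Fin d → ℤ) (u : SP d n) :
    ‖four k u‖ ≤ |mean (u * cosMode k)| + |mean (u * sinMode k)| := by
  rw [four_apply]
  refine (norm_sub_le _ _).trans (le_of_eq ?_)
  rw [norm_mul, Complex.norm_I, mul_one, Complex.norm_real, Complex.norm_real, Real.norm_eq_abs,
    Real.norm_eq_abs]

lemma four_D (p : Fin n × Fin d) (k : Fin n × Fin d → ℤ) (u : SP d n) :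
    four k (D p u) = (2 * π * k p * Complex.I : ℂ) * four k u := by
  have h1 := mean_mul_D p u (cosMode k)
  have h2 := mean_mul_D p u (sinMode k)
  rw [D_cosMode, mul_smul_comm, map_smul, smul_eq_mul] at h1
  rw [D_sinMode, mul_smul_comm, map_smul, smul_eq_mul] at h2
  have h1' : mean (D p u * cosMode k) = 2 * π * k p * mean (u * sinMode k) := by linarith
  have h2' : mean (D p u * sinMode k) = -(2 * π * k p * mean (u * cosMode k)) := by linarith
  rw [four_apply, four_apply, h1', h2']
  push_cast
  linear_combination (2 * π * k p * mean (u * sinMode k) : ℂ) * Complex.I_sq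

lemma four_D_pow (p : Fin n × Fin d) (k : Fin n × Fin d → ℤ) (ℓ : ℕ) (u : SP d n) :
    four k ((D p ^ ℓ) u) = (2 * π * k p * Complex.I : ℂ) ^ ℓ * four k u := by
  induction ℓ with
  | zero => simp
  | succ ℓ ih => 
    rw [pow_succ', Module.End.mul_apply, four_D, ih]
    ring

lemma mFourier_toTorus (k : Fin n × Fin d → ℤ) (y : Dom d n) :
    UnitAddTorus.mFourier (-k) (toTorus y)
      = (Real.cos (phase k y) : ℂ) - Real.sin (phase k y) * Complex.I := by
  have h : UnitAddTorus.mFourier (-k) (toTorus y) = Complex.exp ((-phase k y : ℝ) * Complex.I) := by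
    simp only [UnitAddTorus.mFourier, ContinuousMap.coe_mk, toTorus, fourier_coe_apply,
      ← Complex.exp_sum, phase_apply]
    congr 1
    push_cast
    rw [← Finset.sum_neg_distrib, Finset.sum_mul]
    refine Finset.sum_congr rfl fun p _ => ?_
    simp only [Pi.neg_apply, Int.cast_neg]
    ring
  rw [h, Complex.exp_mul_I, ← Complex.ofReal_cos, ← Complex.ofReal_sin, Real.cos_neg, Real.sin_neg]
  push_cast
  ring

lemma mFourierCoeff_lift {u : SP d n} {g : C(UnitAddTorus (Fin n × Fin d), ℂ)}
    (hg : ∀ y, g (toTorus y) = (u y : ℂ)) (k : Fin n × Fin d → ℤ) :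
    UnitAddTorus.mFourierCoeff g k = four k u := by
  have h1 : UnitAddTorus.mFourierCoeff g k
      = ∫ y in cell d n, UnitAddTorus.mFourier (-k) (toTorus y) • g (toTorus y) := by
    rw [UnitAddTorus.mFourierCoeff_eq_integral g k 0, setIntegral_cell]
    rfl
  have h2 : ∀ y : Dom d n, UnitAddTorus.mFourier (-k) (toTorus y) • g (toTorus y)
      = (((u * cosMode k) y : ℝ) : ℂ) - (((u * sinMode k) y : ℝ) : ℂ) * Complex.I := by
    intro y
    rw [mFourier_toTorus, hg, SP.mul_apply, SP.mul_apply, smul_eq_mul]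
    change _ = ((u y * Real.cos (phase k y) : ℝ) : ℂ)
      - ((u y * Real.sin (phase k y) : ℝ) : ℂ) * Complex.I
    push_cast
    ring
  have hi : ∀ v : SP d n, IntegrableOn (fun y => (v y : ℂ)) (cell d n) := fun v =>
    integrableOn_cell (Complex.continuous_ofReal.comp v.continuous)
  have ho : ∀ v : SP d n, ∫ y in cell d n, ((v y : ℝ) : ℂ) = ((mean v : ℝ) : ℂ) :=
    fun v => integral_ofReal
  rw [h1]
  simp only [h2]
  rw [integral_sub (hi _) ((hi _).mul_const _), integral_mul_const, ho, ho]
  rfl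

/-- A smooth multiperiodic function is bounded by the sum of its Fourier coefficients. -/
lemma abs_le_tsum_of_norm_four_le {u : SP d n} {w : (Fin n × Fin d → ℤ) → ℝ} (hw : Summable w)
    (h : ∀ k, ‖four k u‖ ≤ w k) (y : Dom d n) : |u y| ≤ ∑' k, w k := by
  obtain ⟨g, hg⟩ := exists_torus_lift (f := fun y => (u y : ℂ))
    (Complex.continuous_ofReal.comp u.continuous) fun y z => congrArg _ (u.2.2 y z)
  have hs : Summable (UnitAddTorus.mFourierCoeff g) :=
    Summable.of_norm_bounded hw fun k => by rw [mFourierCoeff_lift hg]; exact h k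
  have h1 := UnitAddTorus.hasSum_mFourier_series_apply_of_summable hs (toTorus y)
  rw [hg] at h1
  rw [← Real.norm_eq_abs, ← Complex.norm_real]
  refine h1.norm_le_of_bounded hw.hasSum fun k => ?_
  rw [norm_smul, mFourierCoeff_lift hg]
  refine (mul_le_of_le_one_right (norm_nonneg _) ?_).trans (h k)
  exact ((UnitAddTorus.mFourier k).norm_coe_le_norm _).trans UnitAddTorus.mFourier_norm.le

/-- The `ℓ¹` size of a frequency. -/
def freqSize (k : Fin n × Fin d → ℤ) : ℝ := ∑ p, |(k p : ℝ)|

lemma abs_le_freqSize (k : Fin n × Fin d → ℤ) (p : Fin n × Fin d) : |(k p : ℝ)| ≤ freqSize k :=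
  Finset.single_le_sum (f := fun p => |(k p : ℝ)|) (fun _ _ => abs_nonneg _) (Finset.mem_univ p)

lemma freqSize_nonneg (k : Fin n × Fin d → ℤ) : 0 ≤ freqSize k :=
  Finset.sum_nonneg fun _ _ => abs_nonneg _

/-- Factorial bounds on powers times `x` give exponential decay of `x`. -/
lemma exp_mul_le_of_pow_mul_le {t R B x : ℝ} (hR : 0 < R)
    (h : ∀ ℓ : ℕ, (2 * π * t) ^ ℓ * x ≤ B * R ^ ℓ * ℓ.factorial) :
    Real.exp (π / R * t) * x ≤ 2 * B := by
  have h1 : HasSum (fun ℓ : ℕ => (π / R * t) ^ ℓ / ℓ.factorial) (Real.exp (π / R * t)) := by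
    rw [Real.exp_eq_exp_ℝ]
    exact NormedSpace.expSeries_div_hasSum_exp _
  have h2 : HasSum (fun ℓ : ℕ => B * (1 / 2 : ℝ) ^ ℓ) (B * 2) := hasSum_geometric_two.mul_left B
  rw [mul_comm 2 B]
  refine hasSum_le (fun ℓ => ?_) (h1.mul_right x) h2
  have hf : (0 : ℝ) < ℓ.factorial := by positivity
  have h3 : (π / R * t) ^ ℓ / ℓ.factorial * x
      = (1 / 2 : ℝ) ^ ℓ * ((2 * π * t) ^ ℓ * x) / (R ^ ℓ * ℓ.factorial) := by
    rw [show π / R * t = 1 / 2 * (2 * π * t) / R by ring, div_pow, mul_pow]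
    field_simp
  rw [h3, div_le_iff₀ (by positivity)]
  calc (1 / 2 : ℝ) ^ ℓ * ((2 * π * t) ^ ℓ * x)
      ≤ (1 / 2 : ℝ) ^ ℓ * (B * R ^ ℓ * ℓ.factorial) :=
        mul_le_mul_of_nonneg_left (h ℓ) (by positivity)
    _ = _ := by ring

/-- A function all of whose pure derivatives obey analytic bounds in the mean has exponentially
decaying Fourier coefficients. -/
lemma norm_four_le_exp [Nonempty (Fin n × Fin d)] {F : SP d n} {M R : ℝ} (hR : 0 < R)
    (hF : ∀ (p : Fin n × Fin d) (w : SP d n), mean (w * w) ≤ 1 → ∀ ℓ : ℕ,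
      |mean ((D p ^ ℓ) F * w)| ≤ M * R ^ ℓ * ℓ.factorial) (k : Fin n × Fin d → ℤ) :
    ‖four k F‖ ≤ 4 * M * Real.exp (-(π / R / (n * d) * freqSize k)) := by
  have h1 : ∀ p ℓ, (2 * π * |(k p : ℝ)|) ^ ℓ * ‖four k F‖ ≤ 2 * M * R ^ ℓ * ℓ.factorial := by
    intro p ℓ
    have h2 : ‖four k ((D p ^ ℓ) F)‖ = (2 * π * |(k p : ℝ)|) ^ ℓ * ‖four k F‖ := by
      rw [four_D_pow, norm_mul, norm_pow, norm_mul, norm_mul, norm_mul, Complex.norm_I,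
        Complex.norm_intCast, Complex.norm_real, Real.norm_eq_abs, abs_of_pos pi_pos]
      simp
    rw [← h2]
    linarith [norm_four_le k ((D p ^ ℓ) F), hF p _ (mean_cosMode_sq k) ℓ,
      hF p _ (mean_sinMode_sq k) ℓ]
  obtain ⟨p, -, hp⟩ := Finset.exists_max_image Finset.univ (fun p => |(k p : ℝ)|)
    (Finset.univ_nonempty (α := Fin n × Fin d))
  have h3 : freqSize k ≤ n * d * |(k p : ℝ)| := by
    have := Finset.sum_le_card_nsmul Finset.univ (fun p => |(k p : ℝ)|) _ fun q hq => hp q hq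
    simpa [nsmul_eq_mul, freqSize] using this
  have hnd : (0 : ℝ) < n * d := by
    have : 0 < Fintype.card (Fin n × Fin d) := Fintype.card_pos
    rw [Fintype.card_prod, Fintype.card_fin, Fintype.card_fin] at this
    exact_mod_cast this
  have h4 := exp_mul_le_of_pow_mul_le hR (h1 p)
  have h5 : Real.exp (π / R / (n * d) * freqSize k) ≤ Real.exp (π / R * |(k p : ℝ)|) := by
    refine Real.exp_le_exp.2 ?_
    rw [div_mul_eq_mul_div, div_le_iff₀ hnd]
    have : 0 ≤ π / R := by positivity
    calc π / R * freqSize k ≤ π / R * (n * d * |(k p : ℝ)|) := mul_le_mul_of_nonneg_left h3 this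
      _ = _ := by ring
  rw [Real.exp_neg, ← div_eq_mul_inv, le_div_iff₀ (Real.exp_pos _)]
  calc ‖four k F‖ * Real.exp (π / R / (n * d) * freqSize k)
      ≤ ‖four k F‖ * Real.exp (π / R * |(k p : ℝ)|) :=
        mul_le_mul_of_nonneg_left h5 (norm_nonneg _)
    _ ≤ 4 * M := by linarith

lemma summable_exp_neg_mul_abs {s : ℝ} (hs : 0 < s) :
    Summable fun m : ℤ => Real.exp (-(s * |(m : ℝ)|)) := by
  have h : Summable fun m : ℕ => Real.exp (-(s * |((m : ℤ) : ℝ)|)) := by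
    refine (Real.summable_exp_nat_mul_iff.2 (neg_lt_zero.2 hs)).congr fun m => ?_
    congr 1
    rw [Int.cast_natCast, Nat.abs_cast]
    ring
  refine Summable.of_nat_of_neg h (h.congr fun m => ?_)
  rw [Int.cast_neg, abs_neg]

lemma summable_exp_neg_freqSize {s : ℝ} (hs : 0 < s) :
    Summable fun k : Fin n × Fin d → ℤ => Real.exp (-(s * freqSize k)) := by
  set g : ℤ → ℝ := fun m => Real.exp (-(s * |(m : ℝ)|)) with hg
  have hgs : Summable g := summable_exp_neg_mul_abs hs
  have hprod : ∀ k : Fin n × Fin d → ℤ, Real.exp (-(s * freqSize k)) = ∏ p, g (k p) := by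
    intro k
    rw [freqSize, Finset.mul_sum, ← Finset.sum_neg_distrib, Real.exp_sum]
  refine summable_of_sum_le (c := ∏ _p : Fin n × Fin d, ∑' m, g m)
    (fun _ => (Real.exp_pos _).le) fun T => ?_
  calc ∑ k ∈ T, Real.exp (-(s * freqSize k))
      ≤ ∑ k ∈ Fintype.piFinset fun p => T.image fun k => k p, Real.exp (-(s * freqSize k)) := by
        refine Finset.sum_le_sum_of_subset_of_nonneg (fun k hk => ?_)
          fun _ _ _ => (Real.exp_pos _).le
        exact Fintype.mem_piFinset.2 fun p => Finset.mem_image_of_mem (fun k => k p) hk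
    _ = ∏ p, ∑ m ∈ T.image fun k => k p, g m := by
        rw [Finset.prod_univ_sum]
        exact Finset.sum_congr rfl fun k _ => hprod k
    _ ≤ _ := Finset.prod_le_prod (fun p _ => Finset.sum_nonneg fun _ _ => (Real.exp_pos _).le)
        fun p _ => hgs.sum_le_tsum _ fun _ _ => (Real.exp_pos _).le

/-- The directional derivative `(∇̂)_l`. -/
def gr (δ : Fin n → ℝ) (l : Fin d) : SP d n →ₗ[ℝ] SP d n := ∑ i, (δ i)⁻¹ • D (i, l)

lemma gr_eq_sum (δ : Fin n → ℝ) (l : Fin d) (u : SP d n) :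
    gr δ l u = ∑ i, (δ i)⁻¹ • D (i, l) u := by
  simp [gr]

lemma gradHatC_coe (δ : Fin n → ℝ) (l : Fin d) (u : SP d n) :
    gradHatC δ n l u = gr δ l u := by
  funext y
  rw [gr_eq_sum, SP.sum_apply]
  exact Finset.sum_congr rfl fun i _ => if_pos i.2

lemma D_pow_gr (δ : Fin n → ℝ) (l : Fin d) (q : Fin n × Fin d) (ℓ : ℕ) (u : SP d n) :
    (D q ^ ℓ) (gr δ l u) = gr δ l ((D q ^ ℓ) u) := by
  simp only [gr_eq_sum, map_sum, map_smul, D_pow_comm]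

lemma mean_mul_gr (δ : Fin n → ℝ) (l : Fin d) (u v : SP d n) :
    mean (u * gr δ l v) = -mean (gr δ l u * v) := by
  simp only [gr_eq_sum, Finset.mul_sum, Finset.sum_mul, map_sum, mul_smul_comm, smul_mul_assoc,
    map_smul, mean_mul_D, smul_neg, Finset.sum_neg_distrib]

/-- The frequency seen by `(∇̂)_l` on the mode `k`. -/
def xi (δ : Fin n → ℝ) (k : Fin n × Fin d → ℤ) (l : Fin d) : ℝ := ∑ i, (δ i)⁻¹ * k (i, l)

lemma four_gr (δ : Fin n → ℝ) (l : Fin d) (k : Fin n × Fin d → ℤ) (u : SP d n) :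
    four k (gr δ l u) = (2 * π * xi δ k l * Complex.I : ℂ) * four k u := by
  rw [gr_eq_sum, map_sum, xi]
  simp only [map_smul, four_D, Complex.real_smul]
  push_cast
  rw [Finset.mul_sum, Finset.sum_mul, Finset.sum_mul]
  exact Finset.sum_congr rfl fun i _ => by ring

lemma norm_four_gr (δ : Fin n → ℝ) (l : Fin d) (k : Fin n × Fin d → ℤ) (u : SP d n) :
    ‖four k (gr δ l u)‖ = 2 * π * |xi δ k l| * ‖four k u‖ := by
  rw [four_gr, norm_mul, norm_mul, norm_mul, norm_mul, Complex.norm_I, Complex.norm_real,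
    Complex.norm_real, Real.norm_eq_abs, Real.norm_eq_abs, abs_of_pos pi_pos]
  simp

lemma four_zero (u : SP d n) : four 0 u = mean u := by
  have h1 : cosMode (0 : Fin n × Fin d → ℤ) = 1 := by
    ext y
    change Real.cos (phase 0 y) = 1
    simp [phase_apply]
  have h2 : sinMode (0 : Fin n × Fin d → ℤ) = 0 := by
    ext y
    change Real.sin (phase 0 y) = 0
    simp [phase_apply]
  simp [four_apply, h1, h2]

lemma four_one {k : Fin n × Fin d → ℤ} (hk : k ≠ 0) : four k 1 = 0 := by
  obtain ⟨p, hp⟩ := Function.ne_iff.1 hk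
  have h1 : D p (1 : SP d n) = 0 := by
    ext y
    rw [D_apply]
    change fderiv ℝ (fun _ => (1 : ℝ)) y (dir p) = 0
    simp
  have h2 := four_D p k 1
  rw [h1, map_zero] at h2
  have hp' : (k p : ℂ) ≠ 0 := Int.cast_ne_zero.2 hp
  have hpi : (π : ℂ) ≠ 0 := Complex.ofReal_ne_zero.2 pi_ne_zero
  simpa [hp', hpi, Complex.I_ne_zero] using h2.symm

/-- The squared symbol of `∇̂` on the mode `k`. -/
def symb (δ : Fin n → ℝ) (k : Fin n × Fin d → ℤ) : ℝ := ∑ l, (2 * π * |xi δ k l|) ^ 2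

lemma symb_nonneg (δ : Fin n → ℝ) (k : Fin n × Fin d → ℤ) : 0 ≤ symb δ k :=
  Finset.sum_nonneg fun _ _ => sq_nonneg _

lemma sq_le_symb (δ : Fin n → ℝ) (k : Fin n × Fin d → ℤ) (l : Fin d) :
    (2 * π * |xi δ k l|) ^ 2 ≤ symb δ k :=
  Finset.single_le_sum (f := fun l => (2 * π * |xi δ k l|) ^ 2) (fun _ _ => sq_nonneg _)
    (Finset.mem_univ l)

section Poisson

variable {δ : Fin n → ℝ} {τ : ℝ} {V F : SP d n}

lemma symb_add_mul_four
    (hV : -(∑ l, gr δ l (gr δ l V)) + τ ^ 2 • V = mean F • 1 - F) (k : Fin n × Fin d → ℤ) :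
    ((symb δ k + τ ^ 2 : ℝ) : ℂ) * four k V = mean F * four k 1 - four k F := by
  have h := congrArg (four k) hV
  simp only [map_add, map_neg, map_sum, map_sub, map_smul, four_gr, Complex.real_smul] at h
  rw [← h, symb]
  push_cast
  rw [add_mul, Finset.sum_mul, ← Finset.sum_neg_distrib]
  congr 1
  refine Finset.sum_congr rfl fun l _ => ?_
  have h1 : ((|xi δ k l| : ℝ) : ℂ) ^ 2 = (xi δ k l : ℂ) ^ 2 := by
    rw [← Complex.ofReal_pow, sq_abs, Complex.ofReal_pow]
  linear_combination 4 * (π : ℂ) ^ 2 * four k V * h1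
    + 4 * (π : ℂ) ^ 2 * (xi δ k l : ℂ) ^ 2 * four k V * Complex.I_sq

lemma symb_add_mul_norm_four_le
    (hV : -(∑ l, gr δ l (gr δ l V)) + τ ^ 2 • V = mean F • 1 - F) (k : Fin n × Fin d → ℤ) :
    (symb δ k + τ ^ 2) * ‖four k V‖ ≤ ‖four k F‖ := by
  have h := congrArg norm (symb_add_mul_four hV k)
  rw [norm_mul, Complex.norm_real, Real.norm_eq_abs,
    abs_of_nonneg (add_nonneg (symb_nonneg δ k) (sq_nonneg τ))] at h
  rw [h]
  by_cases hk : k = 0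
  · subst hk
    rw [four_zero, four_zero, mean_one]
    simp
  · rw [four_one hk]
    simp

lemma four_zero_eq_zero (hτ : 0 < τ)
    (hV : -(∑ l, gr δ l (gr δ l V)) + τ ^ 2 • V = mean F • 1 - F) : four 0 V = 0 := by
  have h := symb_add_mul_four hV 0
  rw [four_zero 1, four_zero F, mean_one, Complex.ofReal_one, mul_one, sub_self] at h
  refine (mul_eq_zero.1 h).resolve_left (Complex.ofReal_ne_zero.2 ?_)
  have := symb_nonneg δ (0 : Fin n × Fin d → ℤ)
  positivity

end Poisson

/-- Near-resonances of the directional frequencies cost exponentially little: either the symbol is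
at least one, or some scale ratio is beaten by the frequency. -/
lemma one_le_symb_or_exp_le {δ : Fin n → ℝ} (hδ : ∀ i, 0 < δ i) (hδ1 : ∀ i, δ i ≤ 1) {s τ : ℝ}
    (hs : 0 < s)
    (hτ : ∀ i j : Fin n, i < j → Real.exp (-(s / (8 * n) * (δ i / δ j))) ≤ τ)
    {k : Fin n × Fin d → ℤ} (hk : k ≠ 0) :
    1 ≤ symb δ k ∨ Real.exp (-(s / 2 * freqSize k)) ≤ τ ^ 2 := by
  obtain ⟨p, hp⟩ := Function.ne_iff.1 hk
  obtain ⟨j, hj, hmax⟩ := Finset.exists_max_image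
    (Finset.univ.filter fun j : Fin n => ∃ l : Fin d, k (j, l) ≠ 0) id
    ⟨p.1, Finset.mem_filter.2 ⟨Finset.mem_univ _, p.2, hp⟩⟩
  obtain ⟨-, l, hl⟩ := Finset.mem_filter.1 hj
  have hn : (0 : ℝ) < n := Nat.cast_pos.2 j.pos
  have hδj := hδ j
  by_cases hsmall : ∀ i, i ≠ j → |(δ i)⁻¹ * (k (i, l) : ℝ)| ≤ (2 * n * δ j)⁻¹
  · left
    have h1 : (δ j)⁻¹ ≤ |(δ j)⁻¹ * (k (j, l) : ℝ)| := by
      rw [abs_mul, abs_of_pos (inv_pos.2 hδj)]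
      refine le_mul_of_one_le_right (inv_pos.2 hδj).le ?_
      exact_mod_cast Int.one_le_abs hl
    have h2 : |∑ i ∈ Finset.univ.erase j, (δ i)⁻¹ * (k (i, l) : ℝ)| ≤ (2 * δ j)⁻¹ := by
      refine (Finset.abs_sum_le_sum_abs _ _).trans ((Finset.sum_le_sum fun i hi =>
        hsmall i (Finset.ne_of_mem_erase hi)).trans ?_)
      rw [Finset.sum_const, nsmul_eq_mul]
      have hc : ((Finset.univ.erase j).card : ℝ) ≤ n := by
        exact_mod_cast (Finset.card_erase_le).trans (by simp)
      calc _ ≤ (n : ℝ) * (2 * n * δ j)⁻¹ := mul_le_mul_of_nonneg_right hc (by positivity)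
        _ = (2 * δ j)⁻¹ := by field_simp
    have h3 : xi δ k l = (δ j)⁻¹ * k (j, l)
        + ∑ i ∈ Finset.univ.erase j, (δ i)⁻¹ * (k (i, l) : ℝ) :=
      (Finset.add_sum_erase _ _ (Finset.mem_univ j)).symm
    have h4 : 1 / 2 ≤ |xi δ k l| := by
      have h5 := abs_sub_abs_le_abs_sub ((δ j)⁻¹ * (k (j, l) : ℝ))
        (-∑ i ∈ Finset.univ.erase j, (δ i)⁻¹ * (k (i, l) : ℝ))
      rw [abs_neg, sub_neg_eq_add, ← h3] at h5
      have h6 : (2 * δ j)⁻¹ = (δ j)⁻¹ / 2 := by rw [mul_inv]; ring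
      have h7 : 1 ≤ (δ j)⁻¹ := (one_le_inv₀ hδj).2 (hδ1 j)
      linarith
    refine le_trans (one_le_pow₀ ?_) (sq_le_symb δ k l)
    nlinarith [pi_gt_three]
  · right
    push Not at hsmall
    obtain ⟨i, hij, hi⟩ := hsmall
    have hki : k (i, l) ≠ 0 := by
      intro h0
      rw [h0, Int.cast_zero, mul_zero, abs_zero] at hi
      exact absurd hi (not_lt.2 (by positivity))
    have hlt : i < j := lt_of_le_of_ne
      (hmax i (Finset.mem_filter.2 ⟨Finset.mem_univ _, l, hki⟩)) hij
    have h1 : δ i / δ j ≤ 2 * n * freqSize k := by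
      rw [abs_mul, abs_of_pos (inv_pos.2 (hδ i))] at hi
      have h2 := mul_lt_mul_of_pos_left hi (show 0 < 2 * n * δ i by have := hδ i; positivity)
      have h3 : 2 * n * δ i * (2 * n * δ j)⁻¹ = δ i / δ j := by field_simp
      have h4 : 2 * n * δ i * ((δ i)⁻¹ * |(k (i, l) : ℝ)|) = 2 * n * |(k (i, l) : ℝ)| := by
        have := (hδ i).ne'
        field_simp
      rw [h3, h4] at h2
      exact h2.le.trans (mul_le_mul_of_nonneg_left (abs_le_freqSize k (i, l)) (by positivity))
    calc Real.exp (-(s / 2 * freqSize k))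
        ≤ Real.exp (-(s / (8 * n) * (δ i / δ j))) ^ 2 := by
          rw [← Real.exp_nat_mul]
          refine Real.exp_le_exp.2 ?_
          have h5 := mul_le_mul_of_nonneg_left h1 (show 0 ≤ s / (4 * n) by positivity)
          have h6 : s / (4 * n) * (2 * n * freqSize k) = s / 2 * freqSize k := by
            field_simp
            ring
          have h7 : (2 : ℕ) * -(s / (8 * n) * (δ i / δ j)) = -(s / (4 * n) * (δ i / δ j)) := by
            push_cast
            field_simp
            ring
          rw [h7]
          linarith
      _ ≤ τ ^ 2 := pow_le_pow_left₀ (Real.exp_pos _).le (hτ i j hlt) 2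

/-- Solutions of the regularized Poisson equation with exponentially decaying data. -/
lemma one_add_symb_mul_norm_four_le {δ : Fin n → ℝ} (hδ : ∀ i, 0 < δ i) (hδ1 : ∀ i, δ i ≤ 1)
    {s τ E : ℝ} (hs : 0 < s) (hτ : 0 < τ)
    (hδτ : ∀ i j : Fin n, i < j → Real.exp (-(s / (8 * n) * (δ i / δ j))) ≤ τ)
    {V F : SP d n} (hV : -(∑ l, gr δ l (gr δ l V)) + τ ^ 2 • V = mean F • 1 - F)
    (hF : ∀ k, ‖four k F‖ ≤ E * Real.exp (-(s * freqSize k))) (k : Fin n × Fin d → ℤ) :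
    (1 + symb δ k) * ‖four k V‖ ≤ 2 * E * Real.exp (-(s / 2 * freqSize k)) := by
  have hE : 0 ≤ E := nonneg_of_mul_nonneg_left ((norm_nonneg _).trans (hF 0)) (Real.exp_pos _)
  by_cases hk : k = 0
  · subst hk
    rw [four_zero_eq_zero hτ hV, norm_zero, mul_zero]
    positivity
  set e := Real.exp (-(s / 2 * freqSize k)) with he
  have he0 : 0 < e := Real.exp_pos _
  have he1 : e ≤ 1 := Real.exp_le_one_iff.2 (by
    have := freqSize_nonneg k
    have : 0 ≤ s / 2 * freqSize k := by positivity
    linarith)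
  have hee : Real.exp (-(s * freqSize k)) = e * e := by
    rw [he, ← Real.exp_add]
    congr 1
    ring
  have h1 := (symb_add_mul_norm_four_le hV k).trans (hF k)
  rw [hee] at h1
  set x := ‖four k V‖ with hx
  have hx0 : 0 ≤ x := norm_nonneg _
  have hw := symb_nonneg δ k
  have hEe : 0 ≤ E * e := by positivity
  have h2 : E * (e * e) ≤ E * e := by
    rw [← mul_assoc]
    exact mul_le_of_le_one_right hEe he1
  have hτx : 0 ≤ τ ^ 2 * x := by positivity
  have h3 : symb δ k * x ≤ E * e := by linarith
  have h4 : x ≤ E * e := by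
    rcases one_le_symb_or_exp_le hδ hδ1 hs hδτ hk with h | h
    · exact (le_mul_of_one_le_left hx0 h).trans h3
    · have h5 : τ ^ 2 * x ≤ τ ^ 2 * (E * e) := by
        have h6 : E * e * e ≤ E * e * τ ^ 2 := mul_le_mul_of_nonneg_left h hEe
        have h7 : 0 ≤ symb δ k * x := by positivity
        linarith
      exact le_of_mul_le_mul_left h5 (by positivity)
  linarith

/-- Uniform bounds on the solution, its directional gradient and directional Hessian. -/
lemma abs_le_of_poisson {δ : Fin n → ℝ} (hδ : ∀ i, 0 < δ i) (hδ1 : ∀ i, δ i ≤ 1)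
    {s τ E : ℝ} (hs : 0 < s) (hτ : 0 < τ)
    (hδτ : ∀ i j : Fin n, i < j → Real.exp (-(s / (8 * n) * (δ i / δ j))) ≤ τ)
    {V F : SP d n} (hV : -(∑ l, gr δ l (gr δ l V)) + τ ^ 2 • V = mean F • 1 - F)
    (hF : ∀ k, ‖four k F‖ ≤ E * Real.exp (-(s * freqSize k))) {B : ℝ}
    (hB : B = ∑' k : Fin n × Fin d → ℤ, 2 * E * Real.exp (-(s / 2 * freqSize k))) :
    (∀ y, |V y| ≤ B) ∧ (∀ l y, |gr δ l V y| ≤ B) ∧ ∀ k l y, |gr δ k (gr δ l V) y| ≤ B := by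
  have hsum : Summable fun k : Fin n × Fin d → ℤ => 2 * E * Real.exp (-(s / 2 * freqSize k)) :=
    (summable_exp_neg_freqSize (half_pos hs)).mul_left _
  have hmain := one_add_symb_mul_norm_four_le hδ hδ1 hs hτ hδτ hV hF
  rw [hB]
  refine ⟨fun y => abs_le_tsum_of_norm_four_le hsum (fun k => ?_) y,
    fun l y => abs_le_tsum_of_norm_four_le hsum (fun k => ?_) y,
    fun a b y => abs_le_tsum_of_norm_four_le hsum (fun k => ?_) y⟩
  · exact (le_mul_of_one_le_left (norm_nonneg _) (by linarith [symb_nonneg δ k])).trans (hmain k)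
  · rw [norm_four_gr]
    refine (mul_le_mul_of_nonneg_right ?_ (norm_nonneg _)).trans (hmain k)
    nlinarith [sq_le_symb δ k l, sq_nonneg (2 * π * |xi δ k l| - 1)]
  · rw [norm_four_gr, norm_four_gr, ← mul_assoc]
    refine (mul_le_mul_of_nonneg_right ?_ (norm_nonneg _)).trans (hmain k)
    nlinarith [sq_le_symb δ k a, sq_le_symb δ k b,
      sq_nonneg (2 * π * |xi δ k a| - 2 * π * |xi δ k b|)]

/-- The flux of the regularized corrector pairs nonpositively with its gradient after
differentiation. -/
lemma sum_mean_D_pow_flux_mul_nonpos {δ : Fin n → ℝ} {τ : ℝ} {F : Fin d → SP d n} {x : SP d n}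
    (hx : ∑ k, gr δ k (F k) = τ ^ 2 • x) (p : Fin n × Fin d) (ℓ : ℕ) :
    ∑ k, mean ((D p ^ ℓ) (F k) * (D p ^ ℓ) (gr δ k x)) ≤ 0 := by
  have h := congrArg (fun u => (D p ^ ℓ) u) hx
  simp only [map_sum, D_pow_gr, map_smul] at h
  simp only [D_pow_gr, mean_mul_gr, Finset.sum_neg_distrib]
  rw [← map_sum, ← Finset.sum_mul, h, smul_mul_assoc, map_smul, smul_eq_mul]
  have := mean_mul_self_nonneg ((D p ^ ℓ) x)
  have : 0 ≤ τ ^ 2 * mean ((D p ^ ℓ) x * (D p ^ ℓ) x) := by positivity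
  linarith

/-- Ellipticity in integrated form. -/
lemma Elliptic.mul_sum_mean_le {lam : ℝ} {a : Fin d → Fin d → SP d n}
    (h : Elliptic lam fun y k l => a k l y) (v : Fin d → SP d n) :
    lam * ∑ k, mean (v k * v k) ≤ ∑ k, ∑ l, mean (a k l * v l * v k) := by
  have h1 : mean (lam • ∑ k, v k * v k) ≤ mean (∑ k, ∑ l, a k l * v l * v k) := by
    refine mean_mono fun y => ?_
    have h2 := (h y fun k => v k y).1
    simp only [SP.smul_apply, SP.sum_apply, SP.mul_apply]
    simp only [Finset.mul_sum] at h2 ⊢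
    refine le_of_eq_of_le (Finset.sum_congr rfl fun k _ => by ring)
      (h2.trans_eq (Finset.sum_congr rfl fun k _ => Finset.sum_congr rfl fun l _ => by ring))
  simpa only [map_smul, map_sum, smul_eq_mul] using h1

/-- Exponential decay of the Fourier coefficients of the flux of a regularized corrector. -/
lemma norm_four_flux_le [Nonempty (Fin n × Fin d)] {lam C₀ Λ K : ℝ} (hlam : 0 < lam)
    (hC₀ : 0 ≤ C₀) (hΛ : 0 < Λ) (hK0 : 0 ≤ K) (hK : (d + d ^ 2) * C₀ ≤ lam * K)
    {a : Fin d → Fin d → SP d n} (hell : Elliptic lam fun y k l => a k l y)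
    (ha : ∀ p k l, AnalyticBound p C₀ Λ (a k l)) {δ : Fin n → ℝ} {τ : ℝ} {x : SP d n} {j : Fin d}
    (hx : ∑ k, gr δ k (a k j + ∑ l, a k l * gr δ l x) = τ ^ 2 • x) (i : Fin d)
    (k : Fin n × Fin d → ℤ) :
    ‖four k (a i j + ∑ l, a i l * gr δ l x)‖ ≤ 4 * (C₀ * (1 + d * (K + 1)))
      * Real.exp (-(π / (Λ * (1 + K)) / (n * d) * freqSize k)) := by
  refine norm_four_le_exp (by positivity) (fun p w hw ℓ => ?_) k
  exact abs_mean_D_pow_flux_mul_le hC₀ hΛ.le (ha p) (fun k => ha p k j) hK0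
    (vecNorm_D_pow_le hlam hC₀ hΛ.le (ha p) (fun k => ha p k j) hell.mul_sum_mean_le
      (sum_mean_D_pow_flux_mul_nonpos hx p) hK) hw ℓ i

lemma analyticBound_of_sum_DAbs_le {C₀ Λ : ℝ} {a : Fin d → Fin d → SP d n}
    (h : ∀ (ℓ : ℕ) (y : Dom d n), ∑ k, ∑ l, DAbs ℓ (a k l) y ≤ C₀ * Λ ^ ℓ * ℓ.factorial)
    (p : Fin n × Fin d) (k l : Fin d) : AnalyticBound p C₀ Λ (a k l) := by
  intro ℓ y
  have h0 : ∀ k l, 0 ≤ DAbs ℓ (a k l) y := fun k l => Finset.sum_nonneg fun _ _ => abs_nonneg _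
  calc |(D p ^ ℓ) (a k l) y| ≤ DAbs ℓ (a k l) y := abs_D_pow_le_DAbs p ℓ _ y
    _ ≤ ∑ l, DAbs ℓ (a k l) y := Finset.single_le_sum (f := fun l => DAbs ℓ (a k l) y)
        (fun l _ => h0 k l) (Finset.mem_univ l)
    _ ≤ ∑ k, ∑ l, DAbs ℓ (a k l) y := Finset.single_le_sum (f := fun k => ∑ l, DAbs ℓ (a k l) y)
        (fun k _ => Finset.sum_nonneg fun l _ => h0 k l) (Finset.mem_univ k)
    _ ≤ _ := h ℓ y

end Auxiliary

/-- Theorem 4.5: uniform pointwise bounds on the multiscale flux correctors. -/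
theorem statement10 (d n : ℕ) (hd : 1 ≤ d) (hn : 2 ≤ n) (lam C₀ Λ₀ : ℝ)
    (hlam : lam ∈ Set.Ioc (0 : ℝ) 1) (hC₀ : 1 ≤ C₀) (hΛ₀ : 0 < Λ₀) :
    ∃ Ct c C : ℝ, 1 ≤ Ct ∧ 0 < c ∧ 1 ≤ C ∧
      ∀ (A : Dom d n → Fin d → Fin d → ℝ),
        (∀ k l, ContDiff ℝ (⊤ : ℕ∞) fun y => A y k l) →
        (∀ k l, MPeriodic fun y => A y k l) →
        Elliptic lam A →
        (∀ (ℓ : ℕ) (y : Dom d n),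
          (∑ k, ∑ l, DAbs ℓ (fun y' => A y' k l) y) ≤ C₀ * Λ₀ ^ ℓ * (Nat.factorial ℓ : ℝ)) →
      ∀ (ε : ℕ → ℝ), ε 1 ≤ 1 → (∀ j : ℕ, 1 ≤ j → j ≤ n → 0 < ε j) →
        (∀ j k : ℕ, 1 ≤ j → j < k → k ≤ n → ε k < ε j) →
        (∀ j : ℕ, 1 ≤ j → j ≤ n - 1 → ε (j + 1) ≤ Ct⁻¹ * ε j) →
      ∀ τ : ℝ, τ ∈ Set.Ioc (0 : ℝ) 1 →
        (∀ i : ℕ, 1 ≤ i → i ≤ n - 1 → Real.exp (-(c * ε i / ε (i + 1))) ≤ τ) →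
      ∀ (X : Fin d → Dom d n → ℝ),
        (∀ j, ContDiff ℝ (⊤ : ℕ∞) (X j)) → (∀ j, MPeriodic (X j)) →
        (∀ (j : Fin d) (y : Dom d n),
          -(∑ k, gradHatC (fun i => ε ((i : ℕ) + 1) / ε 1) n k
              (fun y' => ∑ l, A y' k l
                * gradHatC (fun i' => ε ((i' : ℕ) + 1) / ε 1) n l (X j) y') y)
              + τ ^ 2 * X j y
            = ∑ k, gradHatC (fun i => ε ((i : ℕ) + 1) / ε 1) n k (fun y' => A y' k j) y) →
      ∀ (U : Dom d n → Fin d → Fin d → ℝ),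
        (∀ i j, ContDiff ℝ (⊤ : ℕ∞) fun y => U y i j) →
        (∀ i j, MPeriodic fun y => U y i j) →
        (∀ (i j : Fin d) (y : Dom d n),
          -(∑ k, gradHatC (fun i' => ε ((i' : ℕ) + 1) / ε 1) n k
              (fun y' => gradHatC (fun i'' => ε ((i'' : ℕ) + 1) / ε 1) n k
                (fun y'' => U y'' i j) y') y)
              + τ ^ 2 * U y i j
            = (∫ y' in cell d n,
                (A y' i j + ∑ k, A y' i k
                  * gradHatC (fun i' => ε ((i' : ℕ) + 1) / ε 1) n k (X j) y'))
              - A y i j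
              - ∑ k, A y i k * gradHatC (fun i' => ε ((i' : ℕ) + 1) / ε 1) n k (X j) y) →
        ∀ y₁ y₂ y₃ : Dom d n,
          (∑ i : Fin d, ∑ j : Fin d, ∑ k : Fin d, ∑ l : Fin d,
              |gradHatC (fun i' => ε ((i' : ℕ) + 1) / ε 1) n k
                (fun y' => gradHatC (fun i'' => ε ((i'' : ℕ) + 1) / ε 1) n l
                  (fun y'' => U y'' i j) y') y₁|)
            + (∑ i : Fin d, ∑ j : Fin d, ∑ k : Fin d,
                |gradHatC (fun i' => ε ((i' : ℕ) + 1) / ε 1) n k (fun y' => U y' i j) y₂|)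
            + (∑ i : Fin d, ∑ j : Fin d, |U y₃ i j|)
            ≤ C := by
  have hlam0 : 0 < lam := hlam.1
  have hC₀0 : 0 ≤ C₀ := zero_le_one.trans hC₀
  have hn0 : (0 : ℝ) < n := Nat.cast_pos.2 (by omega)
  have hd0 : (0 : ℝ) < d := Nat.cast_pos.2 (by omega)
  have : Nonempty (Fin n × Fin d) := ⟨⟨0, by omega⟩, ⟨0, by omega⟩⟩
  set K : ℝ := (d + d ^ 2) * C₀ / lam with hKdef
  have hK0 : 0 ≤ K := by positivity
  have hK : (d + d ^ 2) * C₀ ≤ lam * K := by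
    rw [hKdef, mul_div_cancel₀ _ hlam0.ne']
  set s : ℝ := π / (Λ₀ * (1 + K)) / (n * d) with hsdef
  have hs : 0 < s := by positivity
  set E : ℝ := 4 * (C₀ * (1 + d * (K + 1))) with hEdef
  obtain ⟨B, hB⟩ : ∃ B : ℝ,
      B = ∑' k : Fin n × Fin d → ℤ, 2 * E * Real.exp (-(s / 2 * freqSize k)) := ⟨_, rfl⟩
  refine ⟨1, s / (8 * n), max 1 (d ^ 4 * B + d ^ 3 * B + d ^ 2 * B), le_rfl, by positivity,
    le_max_left _ _, ?_⟩
  intro A hAs hAp hAe hAb ε hε1 hεpos hεanti _ τ hτ hετ X hXs hXp hX U hUs hUp hU y₁ y₂ y₃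
  set δ : Fin n → ℝ := fun i => ε ((i : ℕ) + 1) / ε 1 with hδdef
  have hε1pos : 0 < ε 1 := hεpos 1 le_rfl (by omega)
  have hεi : ∀ i : Fin n, 0 < ε ((i : ℕ) + 1) := fun i => hεpos _ (by omega) (by omega)
  have hδ : ∀ i, 0 < δ i := fun i => div_pos (hεi i) hε1pos
  have hεle : ∀ i j : ℕ, 1 ≤ i → i ≤ j → j ≤ n → ε j ≤ ε i := fun i j hi hij hj =>
    hij.eq_or_lt.elim (fun h => h ▸ le_rfl) fun h => (hεanti i j hi h hj).le
  have hδ1 : ∀ i, δ i ≤ 1 := fun i =>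
    (div_le_one hε1pos).2 (hεle 1 _ le_rfl (by omega) (by omega))
  have hδτ : ∀ i j : Fin n, i < j → Real.exp (-(s / (8 * n) * (δ i / δ j))) ≤ τ := by
    intro i j hij
    have hij' : (i : ℕ) < j := hij
    refine le_trans (Real.exp_le_exp.2 (neg_le_neg ?_)) (hετ ((i : ℕ) + 1) (by omega) (by omega))
    have h1 : δ i / δ j = ε ((i : ℕ) + 1) / ε ((j : ℕ) + 1) :=
      div_div_div_cancel_right₀ hε1pos.ne' _ _
    rw [h1, mul_div_assoc]
    refine mul_le_mul_of_nonneg_left ?_ (by positivity)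
    exact div_le_div_of_nonneg_left (hεi i).le (hεi j)
      (hεle _ _ (by omega) (by omega) (by omega))
  let a : Fin d → Fin d → SP d n := fun k l => ⟨fun y => A y k l, hAs k l, hAp k l⟩
  let x : Fin d → SP d n := fun j => ⟨X j, hXs j, hXp j⟩
  let V : Fin d → Fin d → SP d n := fun i j => ⟨fun y => U y i j, hUs i j, hUp i j⟩
  let F : Fin d → Fin d → SP d n := fun i j => a i j + ∑ l, a i l * gr δ l (x j)
  have ha : ∀ k l, (fun y => A y k l) = (a k l : Dom d n → ℝ) := fun _ _ => rfl
  have hxc : ∀ j, X j = (x j : Dom d n → ℝ) := fun _ => rfl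
  have hVc : ∀ i j, (fun y => U y i j) = (V i j : Dom d n → ℝ) := fun _ _ => rfl
  have haF : ∀ k j, (fun y => ∑ l, A y k l * (gr δ l (x j) : SP d n) y)
      = (∑ l, a k l * gr δ l (x j) : SP d n) := fun k j => by
    funext y
    simp only [SP.sum_apply, SP.mul_apply]
    rfl
  have hflux : ∀ j, ∑ k, gr δ k (F k j) = τ ^ 2 • x j := by
    intro j
    ext y
    have h := hX j y
    simp only [hxc, gradHatC_coe, haF, ha] at h
    simp only [F, map_add, SP.sum_apply, SP.add_apply, SP.smul_apply, Finset.sum_add_distrib]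
    linarith
  have hpois : ∀ i j, -(∑ l, gr δ l (gr δ l (V i j))) + τ ^ 2 • V i j
      = mean (F i j) • 1 - F i j := by
    intro i j
    have hm : mean (F i j) = ∫ y' in cell d n,
        (A y' i j + ∑ k, A y' i k * (gr δ k (x j) : SP d n) y') := by
      rw [mean_apply]
      refine integral_congr_ae (Filter.Eventually.of_forall fun y => ?_)
      simp only [F, SP.add_apply, SP.sum_apply, SP.mul_apply]
      rfl
    ext y
    have h := hU i j y
    simp only [hxc, hVc, gradHatC_coe] at h
    rw [← hm] at h
    simp only [F, SP.sum_apply, SP.add_apply, SP.neg_apply, SP.sub_apply, SP.smul_apply,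
      SP.mul_apply, SP.one_apply] at h ⊢
    have h1 : ∀ k l, (a k l) y = A y k l := fun _ _ => rfl
    have h2 : V i j y = U y i j := rfl
    simp only [h1, h2]
    linarith
  have hell : Elliptic lam fun y k l => a k l y := hAe
  have hab : ∀ (ℓ : ℕ) (y : Dom d n), ∑ k, ∑ l, DAbs ℓ (a k l) y ≤ C₀ * Λ₀ ^ ℓ * ℓ.factorial := hAb
  have han := analyticBound_of_sum_DAbs_le hab
  have hdecay : ∀ i j k, ‖four k (F i j)‖ ≤ E * Real.exp (-(s * freqSize k)) := fun i j k =>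
    norm_four_flux_le hlam0 hC₀0 hΛ₀ hK0 hK hell han (hflux j) i k
  have hbound := fun i j => abs_le_of_poisson hδ hδ1 hs hτ.1 hδτ (hpois i j) (hdecay i j) hB
  simp only [hVc, gradHatC_coe]
  refine le_trans (add_le_add (add_le_add ?_ ?_) ?_) (le_max_right _ _)
  · refine (Finset.sum_le_sum fun i _ => Finset.sum_le_sum fun j _ => Finset.sum_le_sum fun k _ =>
      Finset.sum_le_sum fun l _ => (hbound i j).2.2 k l y₁).trans_eq ?_
    simp only [Finset.sum_const, Finset.card_univ, Fintype.card_fin, nsmul_eq_mul]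
    ring
  · refine (Finset.sum_le_sum fun i _ => Finset.sum_le_sum fun j _ => Finset.sum_le_sum fun k _ =>
      (hbound i j).2.1 k y₂).trans_eq ?_
    simp only [Finset.sum_const, Finset.card_univ, Fintype.card_fin, nsmul_eq_mul]
    ring
  · refine (Finset.sum_le_sum fun i _ => Finset.sum_le_sum fun j _ =>
      (hbound i j).1 y₃).trans_eq ?_
    simp only [Finset.sum_const, Finset.card_univ, Fintype.card_fin, nsmul_eq_mul]
    ring

end MS
end
end
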